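/- arXiv:2010.04793 — 2 statements merged into one kernel-verified Lean document; each statement's English description precedes it below -/
import Mathlib

section
/- Let d ≥ 2, α ∈ (1,2), and let μ be a nondegenerate α-stable distribution on ℝ^d with no shift and characteristic exponent Φ_μ(z) = |z|^α V(u_z). Let ζ be a positive (α/2)-stable random variable with E[e^{−tζ}] = e^{−t^{α/2}} for all t ≥ 0. If X ∼ μ, then the density of |X| satisfies g_{|X|}(r) = ((r/2)^{d−1} / (2π^{d/2})) ∫_{S^{d−1}} V^{−d/α}(u) E[ ζ^{−d/2} exp( − r² / (4 V^{2/α}(u) ζ) ) ] ω(du) for r > 0. -/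
open MeasureTheory Real Filter Topology
open scoped RealInnerProductSpace ENNReal NNReal

noncomputable section

namespace StablePaper

abbrev Ed (d : ℕ) : Type := EuclideanSpace ℝ (Fin d)

abbrev Sph (d : ℕ) := Metric.sphere (0 : Ed d) 1

/-- The surface measure `ω` on the unit sphere `S^{d-1}`. -/
def ωd (d : ℕ) : Measure (Sph d) := (volume : Measure (Ed d)).toSphere

/-- `u_z = z/|z|` for `z ≠ 0`, as a point of the unit sphere. -/
def unitize {d : ℕ} (z : Ed d) (hz : z ≠ 0) : Sph d :=
  ⟨‖z‖⁻¹ • z, by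
    rw [mem_sphere_iff_norm, sub_zero, norm_smul, norm_inv, norm_norm,
      inv_mul_cancel₀ (norm_ne_zero_iff.mpr hz)]⟩

/-- Negation on the unit sphere. -/
def negS {d : ℕ} (u : Sph d) : Sph d :=
  ⟨-(u : Ed d), by
    rw [mem_sphere_iff_norm, sub_zero, norm_neg]
    have := u.2
    rwa [mem_sphere_iff_norm, sub_zero] at this⟩

/-- Rising factorial (Pochhammer symbol) `(b)_n`. -/
def risingFactorial (b : ℝ) (n : ℕ) : ℝ := ∏ i ∈ Finset.range n, (b + i)

/-- The Gegenbauer polynomial `C_j^b(t)` (for `b > 0`), via its explicit sum formula. -/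
def gegenbauer (b : ℝ) (j : ℕ) (t : ℝ) : ℝ :=
  ∑ m ∈ Finset.range (j / 2 + 1),
    (-1 : ℝ) ^ m * 2 ^ (j - 2 * m) * risingFactorial b (j - m) /
      ((Nat.factorial m : ℝ) * (Nat.factorial (j - 2 * m) : ℝ)) * t ^ (j - 2 * m)

/-- The normalized (ultraspherical) polynomial `C̃_j^b(t) = C_j^b(t)/C_j^b(1)`;
for `b = 0` it is the Chebyshev polynomial `T_j`. -/
def gegenbauerN (b : ℝ) (j : ℕ) (t : ℝ) : ℝ :=
  if b = 0 then (Polynomial.Chebyshev.T ℝ (j : ℤ)).eval t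
  else gegenbauer b j t / gegenbauer b j 1

/-- `c_{j,d} = dim ℋ_{j,d}`. -/
def cdim (d j : ℕ) : ℕ :=
  if j = 0 then 1 else Nat.choose (j + d - 2) j + Nat.choose (j + d - 3) (j - 1)

/-- The surface area `A(S^{d-1}) = 2 π^{d/2} / Γ(d/2)`. -/
def sphereArea (d : ℕ) : ℝ := 2 * Real.pi ^ ((d : ℝ) / 2) / Real.Gamma ((d : ℝ) / 2)

/-- Projection onto spherical harmonics of degree `j` (real-valued version):
`(proj_j f)(u) = (c_{j,d}/A(S^{d-1})) ∫ C̃_j^{(d-2)/2}(⟨u,v⟩) f(v) ω(dv)`. -/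
def projR (d j : ℕ) (f : Sph d → ℝ) (u : Sph d) : ℝ :=
  (cdim d j : ℝ) / sphereArea d *
    ∫ v, gegenbauerN (((d : ℝ) - 2) / 2) j ⟪(u : Ed d), (v : Ed d)⟫ * f v ∂(ωd d)

/-- Projection onto spherical harmonics of degree `j` (complex-valued version). -/
def projC (d j : ℕ) (f : Sph d → ℂ) (u : Sph d) : ℂ :=
  ((cdim d j : ℂ) / (sphereArea d : ℂ)) *
    ∫ v, (gegenbauerN (((d : ℝ) - 2) / 2) j ⟪(u : Ed d), (v : Ed d)⟫ : ℂ) * f v ∂(ωd d)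

/-- The coefficients `w_j(α)`. -/
def w (d : ℕ) (α : ℝ) (j : ℕ) : ℝ :=
  Real.pi ^ ((d : ℝ) / 2) * Real.Gamma (α + 1) /
    (2 ^ (α - 1) * Real.Gamma (((j : ℝ) + α + d) / 2) * Real.Gamma ((α - j) / 2 + 1))

/-- The characteristic exponent of an `α`-stable distribution (`α ≠ 1`) with
spectral spherical measure `Λ`. -/
def charExp (d : ℕ) (α : ℝ) (Λ : Measure (Sph d)) (z : Ed d) : ℂ :=
  ∫ v, (|⟪z, (v : Ed d)⟫| ^ α : ℝ) *
      (1 - Complex.I * (Real.tan (Real.pi * α / 2) : ℂ) *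
        (Real.sign ⟪z, (v : Ed d)⟫ : ℂ)) ∂Λ

/-- `V(u)`, so that `Φ_μ(z) = |z|^α V(u_z)`. -/
def Vfun (d : ℕ) (α : ℝ) (Λ : Measure (Sph d)) (u : Sph d) : ℂ :=
  charExp d α Λ (u : Ed d)

/-- The characteristic exponent of a `1`-stable distribution with
spectral spherical measure `Λ`. -/
def charExp1 (d : ℕ) (Λ : Measure (Sph d)) (z : Ed d) : ℂ :=
  ∫ v, ((|⟪z, (v : Ed d)⟫| : ℝ) : ℂ) +
      Complex.I * ((2 / Real.pi * (⟪z, (v : Ed d)⟫ *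
        Real.log |⟪z, (v : Ed d)⟫|) : ℝ) : ℂ) ∂Λ

/-- The spectral spherical measure `λ(dv) = P(v) ω(dv)`. -/
def specMeasure (d : ℕ) (P : Sph d → ℝ) : Measure (Sph d) :=
  (ωd d).withDensity (fun v => ENNReal.ofReal (P v))

/-- `μ` has Fourier transform `exp (-Φ)` where `Φ` is the `α`-stable characteristic
exponent with spectral spherical measure `Λ` (case `α ≠ 1`). -/
def IsStableChar (d : ℕ) (α : ℝ) (Λ : Measure (Sph d)) (μ : Measure (Ed d)) : Prop :=
  ∀ z : Ed d, ∫ x, Complex.exp (Complex.I * (⟪z, x⟫ : ℂ)) ∂μ =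
    Complex.exp (- charExp d α Λ z)

/-- `μ` has Fourier transform `exp (-Φ)` where `Φ` is the `1`-stable characteristic
exponent with spectral spherical measure `Λ`. -/
def IsStableChar1 (d : ℕ) (Λ : Measure (Sph d)) (μ : Measure (Ed d)) : Prop :=
  ∀ z : Ed d, ∫ x, Complex.exp (Complex.I * (⟪z, x⟫ : ℂ)) ∂μ =
    Complex.exp (- charExp1 d Λ z)

/-- `μ` is nondegenerate: its support is not contained in any proper affine subspace. -/
def Nondegenerate (d : ℕ) (μ : Measure (Ed d)) : Prop :=
  ∀ (a : Ed d) (W : Submodule ℝ (Ed d)), W ≠ ⊤ →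
    μ ((fun x => a + x) '' (W : Set (Ed d))) < 1

/-- `P` is the restriction to the sphere of a polynomial on `ℝ^d`. -/
def IsPolyRestriction (d : ℕ) (P : Sph d → ℝ) : Prop :=
  ∃ p : MvPolynomial (Fin d) ℝ,
    ∀ u : Sph d, P u = MvPolynomial.eval (fun i => (u : Ed d) i) p

/-- `P` is the restriction to the sphere of a polynomial of degree at most `q`. -/
def IsPolyRestrictionDeg (d q : ℕ) (P : Sph d → ℝ) : Prop :=
  ∃ p : MvPolynomial (Fin d) ℝ, p.totalDegree ≤ q ∧
    ∀ u : Sph d, P u = MvPolynomial.eval (fun i => (u : Ed d) i) p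

/-- `f` is a spherical harmonic of degree `j`: the restriction to the sphere of a
homogeneous harmonic polynomial of degree `j`. -/
def IsSphericalHarmonicC (d j : ℕ) (f : Sph d → ℂ) : Prop :=
  ∃ p : MvPolynomial (Fin d) ℂ, p.IsHomogeneous j ∧
    (∑ i : Fin d, MvPolynomial.pderiv i (MvPolynomial.pderiv i p)) = 0 ∧
    ∀ u : Sph d, f u = MvPolynomial.eval (fun i => ((u : Ed d) i : ℂ)) p

/-- `S_{j,k} = (-i)^j proj_j (V^k)`. -/
def SHk (d : ℕ) (α : ℝ) (Λ : Measure (Sph d)) (j k : ℕ) (u : Sph d) : ℂ :=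
  (-Complex.I) ^ j * projC d j (fun v => (Vfun d α Λ v) ^ k) u

/-- `S_{j,p} = (-i)^j proj_j (V^p)` for real exponents `p` (principal branch). -/
def SHp (d : ℕ) (α : ℝ) (Λ : Measure (Sph d)) (j : ℕ) (p : ℝ) (u : Sph d) : ℂ :=
  (-Complex.I) ^ j * projC d j (fun v => (Vfun d α Λ v) ^ (p : ℂ)) u

/-- `g` is the density of the stable distribution with characteristic exponent
`charExp d α Λ`, given by the Fourier inversion formula. -/
def IsDensityOf (d : ℕ) (α : ℝ) (Λ : Measure (Sph d)) (g : Ed d → ℝ) : Prop :=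
  ∀ x : Ed d, (g x : ℂ) =
    (((2 * Real.pi) ^ d)⁻¹ : ℝ) *
      ∫ z : Ed d, Complex.exp (-(Complex.I * (⟪x, z⟫ : ℂ))) *
        Complex.exp (- charExp d α Λ z)

/-- Harmonic numbers `s_n`. -/
def harmonicNum (n : ℕ) : ℝ := ∑ i ∈ Finset.range n, (1 : ℝ) / (i + 1)

def betaD (d : ℕ) : ℝ :=
  if Even d then 1 - Real.log 2 - harmonicNum (d / 2) / 2
  else 1 - harmonicNum (d + 1) + harmonicNum ((d + 1) / 2) / 2

/-- The coefficients `w*_j` (for odd `j`). -/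
def wstar (d j : ℕ) : ℝ :=
  if j = 1 then Real.pi ^ ((d : ℝ) / 2) * betaD d / Real.Gamma ((d : ℝ) / 2 + 1)
  else (-1 : ℝ) ^ ((j - 3) / 2) * Real.pi ^ ((d : ℝ) / 2) *
      Real.Gamma (((j : ℝ) - 1) / 2) / (2 * Real.Gamma (((d : ℝ) + 1 + j) / 2))

/-- The Bessel function of the first kind `J_τ`. -/
def besselJ (τ : ℝ) (x : ℝ) : ℝ :=
  ∑' k : ℕ, (-1 : ℝ) ^ k * (x / 2) ^ (2 * (k : ℝ) + τ) /
    ((Nat.factorial k : ℝ) * Real.Gamma ((k : ℝ) + τ + 1))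

/-- The `(j,k)`-term `((-2^α)^k π^{-d/2} / (k! ρ^{kα+d})) (Γ((j+kα+d)/2)/Γ((j-kα)/2)) S_{j,k}(u)`
of the spherical-harmonic series for the density (`α ∈ (0,1)`), at radius `ρ`. -/
def phiTerm (d : ℕ) (α : ℝ) (Λ : Measure (Sph d)) (j k : ℕ) (ρ : ℝ) (u : Sph d) : ℂ :=
  ((((-((2 : ℝ) ^ α)) ^ k * Real.pi ^ (-(d : ℝ) / 2) /
      ((Nat.factorial k : ℝ) * ρ ^ ((k : ℝ) * α + d)) *
      (Real.Gamma (((j : ℝ) + k * α + d) / 2) /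
        Real.Gamma (((j : ℝ) - k * α) / 2))) : ℝ) : ℂ) * SHk d α Λ j k u

/-- The `k`-th term `((-2^α)^k π^{-d/2} / (k! r^{kα+1})) (Γ((kα+d)/2)/Γ(-kα/2)) ∫ V^k dω`
of the series for the density of `|X|`. -/
def radTerm (d : ℕ) (α : ℝ) (Λ : Measure (Sph d)) (k : ℕ) (r : ℝ) : ℂ :=
  ((((-((2 : ℝ) ^ α)) ^ k * Real.pi ^ (-(d : ℝ) / 2) /
      ((Nat.factorial k : ℝ) * r ^ ((k : ℝ) * α + 1)) *
      (Real.Gamma (((k : ℝ) * α + d) / 2) / Real.Gamma (-((k : ℝ) * α) / 2))) : ℝ) : ℂ) *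
    ∫ u, (Vfun d α Λ u) ^ k ∂(ωd d)

end StablePaper

namespace StablePaper

/-- An integral depending exponentially on a complex parameter is holomorphic on any open set of
parameters for which the integrand is integrable. -/
lemma differentiableOn_integral_mul_cexp {β : Type*} [MeasurableSpace β] {m : Measure β}
    {k : β → ℂ} {X : β → ℝ} (hk : AEStronglyMeasurable k m) (hX : Measurable X)
    {U : Set ℂ} (hU : IsOpen U)
    (hint : ∀ w ∈ U, Integrable (fun b => k b * Complex.exp (w * X b)) m) :
    DifferentiableOn ℂ (fun w : ℂ => ∫ b, k b * Complex.exp (w * X b) ∂m) U := by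
  intro w hw
  obtain ⟨ε, hε, hball⟩ := Metric.isOpen_iff.1 hU w hw
  have hmem : ∀ a : ℝ, |a| < ε → w + (a : ℂ) ∈ U := by
    intro a ha
    apply hball
    simpa [Metric.mem_ball, dist_eq_norm] using ha
  set δ := ε / 2 with hδ
  have hδ0 : 0 < δ := by positivity
  have h1 := hint _ (hmem δ (by rw [abs_of_pos hδ0]; linarith))
  have h2 := hint _ (hmem (-δ) (by rw [abs_neg, abs_of_pos hδ0]; linarith))
  have hmeas : ∀ w : ℂ, AEStronglyMeasurable (fun b => k b * Complex.exp (w * X b)) m := by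
    intro w
    refine hk.mul (Measurable.aestronglyMeasurable ?_)
    fun_prop
  refine (hasDerivAt_integral_of_dominated_loc_of_deriv_le
    (F := fun (w : ℂ) b => k b * Complex.exp (w * X b))
    (F' := fun (w : ℂ) b => k b * (Complex.exp (w * X b) * X b))
    (bound := fun b => (2 / δ) * (‖k b * Complex.exp ((w + (δ : ℝ)) * X b)‖ +
      ‖k b * Complex.exp ((w + ((-δ : ℝ) : ℂ)) * X b)‖))
    (s := Metric.ball w (δ / 2)) (Metric.ball_mem_nhds w (by positivity))
    (Eventually.of_forall hmeas) (hint w hw) ?_ ?_ ((h1.norm.add h2.norm).const_mul _) ?_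
    ).2.differentiableAt.differentiableWithinAt
  · refine hk.mul (Measurable.aestronglyMeasurable ?_)
    fun_prop
  · refine Eventually.of_forall fun b z hz => ?_
    have hz' : |z.re - w.re| < δ / 2 := by
      have := (Complex.abs_re_le_norm (z - w)).trans_lt (by simpa [dist_eq_norm] using hz)
      simpa using this
    simp only [norm_mul, Complex.norm_exp, Complex.norm_real, Complex.mul_re, Complex.add_re,
      Complex.ofReal_re, Complex.ofReal_im, mul_zero, sub_zero, Real.norm_eq_abs]
    have hkey : Real.exp (z.re * X b) * |X b| ≤
        2 / δ * (Real.exp ((w.re + δ) * X b) + Real.exp ((w.re + -δ) * X b)) := by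
      have hx : |X b| ≤ 2 / δ * Real.exp (δ / 2 * |X b|) := by
        have := Real.add_one_le_exp (δ / 2 * |X b|)
        calc |X b| = 2 / δ * (δ / 2 * |X b|) := by field_simp
          _ ≤ _ := by gcongr; linarith
      have he : Real.exp (z.re * X b) ≤ Real.exp (w.re * X b + δ / 2 * |X b|) := by
        apply Real.exp_le_exp.2
        have : (z.re - w.re) * X b ≤ δ / 2 * |X b| := by
          calc _ ≤ |(z.re - w.re) * X b| := le_abs_self _
            _ = |z.re - w.re| * |X b| := abs_mul _ _
            _ ≤ _ := by gcongr
        linarith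
      calc Real.exp (z.re * X b) * |X b|
          ≤ Real.exp (w.re * X b + δ / 2 * |X b|) * (2 / δ * Real.exp (δ / 2 * |X b|)) := by gcongr
        _ = 2 / δ * Real.exp (w.re * X b + δ * |X b|) := by
            rw [mul_left_comm, ← Real.exp_add]; ring_nf
        _ ≤ _ := by
            gcongr
            rcases abs_cases (X b) with ⟨h, _⟩ | ⟨h, _⟩ <;> rw [h]
            · have := Real.exp_pos ((w.re + -δ) * X b)
              rw [← add_mul]; linarith
            · have := Real.exp_pos ((w.re + δ) * X b)
              rw [show w.re * X b + δ * -X b = (w.re + -δ) * X b by ring]; linarith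
    calc _ ≤ ‖k b‖ * (2 / δ * (Real.exp ((w.re + δ) * X b) + Real.exp ((w.re + -δ) * X b))) := by
          gcongr
      _ = _ := by ring
  · refine Eventually.of_forall fun b z _ => ?_
    have h : HasDerivAt (fun z : ℂ => z * (X b : ℂ)) (X b : ℂ) z := by
      simpa using (hasDerivAt_id z).mul_const (X b : ℂ)
    exact h.cexp.const_mul (k b)

/-- The exponential of a multiple of the square root grows slower than a stretched exponential
with exponent `p > 1/2` decays. -/
lemma integrableOn_exp_sqrt_sub_rpow {p : ℝ} (hp : 1 / 2 < p) {b : ℝ} (hb : 0 ≤ b) :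
    IntegrableOn (fun t : ℝ => Real.exp (b * √t - t ^ p)) (Set.Ioi 0) := by
  have h2p : 1 < 2 * p := by linarith
  set q := Real.conjExponent (2 * p)
  have hpq : (2 * p).HolderConjugate q := Real.HolderConjugate.conjExponent h2p
  have hc : 0 < 1 - 1 / (2 * p) := by
    rw [sub_pos, div_lt_one (by linarith)]; exact h2p
  have hI : IntegrableOn (fun t : ℝ => Real.exp (b ^ q / q) *
      (t ^ (0 : ℝ) * Real.exp (-(1 - 1 / (2 * p)) * t ^ p))) (Set.Ioi 0) :=
    (integrableOn_rpow_mul_exp_neg_mul_rpow (by norm_num) (by linarith) hc).const_mul _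
  refine hI.mono' ?_ ?_
  · exact (by fun_prop : Measurable fun t : ℝ => Real.exp (b * √t - t ^ p)).aestronglyMeasurable
  · refine (ae_restrict_mem measurableSet_Ioi).mono fun t ht => ?_
    have ht : 0 < t := ht
    rw [Real.norm_eq_abs, abs_of_pos (Real.exp_pos _), Real.rpow_zero, one_mul, ← Real.exp_add]
    apply Real.exp_le_exp.2
    have := Real.young_inequality_of_nonneg (Real.sqrt_nonneg t) hb hpq
    have h3 : √t ^ (2 * p) = t ^ p := by
      rw [Real.sqrt_eq_rpow, ← Real.rpow_mul ht.le]; congr 1; ring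
    rw [h3] at this
    have h4 : (1 - 1 / (2 * p)) * t ^ p = t ^ p - t ^ p / (2 * p) := by ring
    nlinarith

/-- A positive random variable whose Laplace transform is `exp (-t ^ p)` with `p > 1/2` has an
inverse with all exponential moments. -/
lemma integrable_exp_div_of_laplace {p : ℝ} (hp : 1 / 2 < p) (ν : Measure ℝ)
    [IsProbabilityMeasure ν] (hpos : ∀ᵐ s ∂ν, 0 < s)
    (hL : ∀ t : ℝ, 0 ≤ t → ∫ s, Real.exp (-(t * s)) ∂ν = Real.exp (-(t ^ p)))
    {c : ℝ} (hc : 0 ≤ c) : Integrable (fun s : ℝ => Real.exp (c / s)) ν := by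
  set b := 2 * √c with hb
  have hb0 : 0 ≤ b := by positivity
  have hb2 : b ^ 2 / 4 = c := by rw [hb, mul_pow, Real.sq_sqrt hc]; ring
  have hlow : ∀ s : ℝ, 0 < s → ENNReal.ofReal (Real.exp (c / s - s)) ≤
      ∫⁻ t in Set.Ioi (0 : ℝ), ENNReal.ofReal (Real.exp (b * √t - t * s)) := by
    intro s hs
    set t₀ := b ^ 2 / (4 * s ^ 2) with ht₀
    have ht₀0 : 0 ≤ t₀ := by positivity
    have hsub : Set.Ioc t₀ (t₀ + 1) ⊆ Set.Ioi 0 := fun t ht => ht₀0.trans_lt ht.1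
    calc ENNReal.ofReal (Real.exp (c / s - s))
        = ∫⁻ t in Set.Ioc t₀ (t₀ + 1), ENNReal.ofReal (Real.exp (c / s - s)) := by
          simp
      _ ≤ ∫⁻ t in Set.Ioc t₀ (t₀ + 1), ENNReal.ofReal (Real.exp (b * √t - t * s)) := by
          refine setLIntegral_mono (by fun_prop) fun t ht => ?_
          apply ENNReal.ofReal_le_ofReal
          apply Real.exp_le_exp.2
          have h1 : b / (2 * s) ≤ √t := by
            apply Real.le_sqrt_of_sq_le
            calc (b / (2 * s)) ^ 2 = t₀ := by rw [ht₀, div_pow, mul_pow 2 s]; norm_num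
              _ ≤ t := ht.1.le
          have h2 : b * (b / (2 * s)) ≤ b * √t := by gcongr
          have h3 : t * s ≤ (t₀ + 1) * s := by gcongr; exact ht.2
          have h4 : b * (b / (2 * s)) - (t₀ + 1) * s = c / s - s := by
            rw [ht₀, ← hb2]; field_simp; ring
          linarith
      _ ≤ _ := lintegral_mono_set hsub
  have hfin : ∫⁻ s, ENNReal.ofReal (Real.exp (c / s - s)) ∂ν < ∞ := by
    calc ∫⁻ s, ENNReal.ofReal (Real.exp (c / s - s)) ∂ν
        ≤ ∫⁻ s, (∫⁻ t in Set.Ioi (0 : ℝ), ENNReal.ofReal (Real.exp (b * √t - t * s))) ∂ν :=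
          lintegral_mono_ae (hpos.mono fun s hs => hlow s hs)
      _ = ∫⁻ t in Set.Ioi (0 : ℝ), (∫⁻ s, ENNReal.ofReal (Real.exp (b * √t - t * s)) ∂ν) :=
          lintegral_lintegral_swap (Measurable.aemeasurable (by fun_prop))
      _ = ∫⁻ t in Set.Ioi (0 : ℝ), ENNReal.ofReal (Real.exp (b * √t - t ^ p)) := by
          refine setLIntegral_congr_fun measurableSet_Ioi fun t ht => ?_
          have ht : 0 < t := ht
          have hint : Integrable (fun s => Real.exp (-(t * s))) ν := by
            by_contra h
            have := hL t ht.le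
            rw [integral_undef h] at this
            exact (Real.exp_pos _).ne this
          have : ∀ s, Real.exp (b * √t - t * s) = Real.exp (b * √t) * Real.exp (-(t * s)) := by
            intro s; rw [← Real.exp_add]; rfl
          simp_rw [this]
          rw [← ofReal_integral_eq_lintegral_ofReal (hint.const_mul _)
            (Eventually.of_forall fun s => by positivity), integral_const_mul, hL t ht.le,
            ← Real.exp_add]
          rfl
      _ < ∞ := (integrableOn_exp_sqrt_sub_rpow hp hb0).lintegral_lt_top
  have hI : Integrable (fun s : ℝ => Real.exp (c / s - s)) ν := by
    refine ⟨(by fun_prop : Measurable fun s : ℝ => Real.exp (c / s - s)).aestronglyMeasurable, ?_⟩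
    rw [hasFiniteIntegral_iff_ofReal (Eventually.of_forall fun s => by positivity)]
    exact hfin
  refine ((integrable_const (Real.exp c)).add (hI.const_mul (Real.exp 1))).mono'
    (by fun_prop : Measurable fun s : ℝ => Real.exp (c / s)).aestronglyMeasurable ?_
  refine hpos.mono fun s hs => ?_
  rw [Real.norm_eq_abs, abs_of_pos (Real.exp_pos _)]
  simp only [Pi.add_apply]
  rw [← Real.exp_add]
  rcases le_total s 1 with h | h
  · have : Real.exp (c / s) ≤ Real.exp (1 + (c / s - s)) := Real.exp_le_exp.2 (by linarith)
    linarith [Real.exp_pos c]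
  · have : Real.exp (c / s) ≤ Real.exp c := Real.exp_le_exp.2 (div_le_self hc h)
    linarith [Real.exp_pos (1 + (c / s - s))]

/-- Version of `integrable_exp_div_of_laplace` with complex exponents and a negative power. -/
lemma integrable_rpow_mul_cexp_inv_of_laplace {p : ℝ} (hp : 1 / 2 < p) (ν : Measure ℝ)
    [IsProbabilityMeasure ν] (hpos : ∀ᵐ s ∂ν, 0 < s)
    (hL : ∀ t : ℝ, 0 ≤ t → ∫ s, Real.exp (-(t * s)) ∂ν = Real.exp (-(t ^ p)))
    (d : ℕ) (w : ℂ) :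
    Integrable (fun s : ℝ => ((s ^ (-(d : ℝ) / 2) : ℝ) : ℂ) *
      Complex.exp (w * ((s⁻¹ : ℝ) : ℂ))) ν := by
  have h := (integrable_exp_div_of_laplace hp ν hpos hL
    (c := ‖w‖ + 1) (by positivity)).const_mul (1 + (d.factorial : ℝ))
  refine h.mono' (Measurable.aestronglyMeasurable (by fun_prop)) ?_
  refine hpos.mono fun s hs => ?_
  rw [norm_mul, Complex.norm_real, Complex.norm_exp, Real.norm_eq_abs,
    abs_of_nonneg (Real.rpow_nonneg hs.le _), Complex.re_mul_ofReal]
  have hx : 0 < s⁻¹ := inv_pos.2 hs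
  have h1 : s ^ (-(d : ℝ) / 2) ≤ (1 + (d.factorial : ℝ)) * Real.exp (s⁻¹) := by
    have e : s ^ (-(d : ℝ) / 2) = s⁻¹ ^ ((d : ℝ) / 2) := by
      rw [Real.inv_rpow hs.le, ← Real.rpow_neg hs.le]; congr 1; ring
    have h2 : s⁻¹ ^ ((d : ℝ) / 2) ≤ 1 + s⁻¹ ^ d := by
      rcases le_total s⁻¹ 1 with h | h
      · have := Real.rpow_le_one hx.le h (by positivity : 0 ≤ (d : ℝ) / 2)
        have : 0 < s⁻¹ ^ d := by positivity
        linarith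
      · have := Real.rpow_le_rpow_of_exponent_le h
          (by linarith [(Nat.cast_nonneg d : (0 : ℝ) ≤ d)] : (d : ℝ) / 2 ≤ d)
        rw [Real.rpow_natCast] at this
        linarith
    have h3 := Real.pow_div_factorial_le_exp s⁻¹ hx.le d
    rw [div_le_iff₀ (by positivity)] at h3
    have h4 := Real.one_le_exp hx.le
    rw [e]; linarith
  have h5 : Real.exp (w.re * s⁻¹) ≤ Real.exp (‖w‖ * s⁻¹) := by
    apply Real.exp_le_exp.2
    gcongr
    exact Complex.re_le_norm w
  calc _ ≤ (1 + (d.factorial : ℝ)) * Real.exp (s⁻¹) * Real.exp (‖w‖ * s⁻¹) := by gcongr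
    _ = _ := by rw [mul_assoc, ← Real.exp_add]; congr 2; ring

lemma integrableOn_pow_mul_exp_neg_mul_rpow (n : ℕ) {α : ℝ} (hα : 0 < α) {m : ℝ} (hm : 0 < m) :
    IntegrableOn (fun y : ℝ => y ^ n • Real.exp (-(m * y ^ α))) (Set.Ioi 0) := by
  refine (integrableOn_rpow_mul_exp_neg_mul_rpow (s := n) (p := α) (b := m)
    (by linarith [(Nat.cast_nonneg n : (0 : ℝ) ≤ n)]) hα hm).congr_fun (fun y _ => ?_)
    measurableSet_Ioi
  simp [Real.rpow_natCast]

lemma integrable_exp_neg_mul_norm_rpow {d : ℕ} (hd : 1 ≤ d) {α : ℝ} (hα : 0 < α) {m : ℝ}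
    (hm : 0 < m) : Integrable (fun z : Ed d => Real.exp (-(m * ‖z‖ ^ α))) := by
  have : Nonempty (Fin d) := ⟨⟨0, hd⟩⟩
  exact (integrable_fun_norm_addHaar volume (f := fun y : ℝ => Real.exp (-(m * y ^ α)))).2
    (integrableOn_pow_mul_exp_neg_mul_rpow _ hα hm)

/-- The Fourier integral of `exp (-V |z| ^ α)`. -/
def radialStableFourier (d : ℕ) (α : ℝ) (x : Ed d) (V : ℂ) : ℂ :=
  ∫ z : Ed d, Complex.exp (-(Complex.I * (⟪x, z⟫ : ℂ))) *
    Complex.exp (V * ((-(‖z‖ ^ α) : ℝ) : ℂ))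

lemma norm_cexp_neg_I_mul (t : ℝ) : ‖Complex.exp (-(Complex.I * (t : ℂ)))‖ = 1 := by
  rw [Complex.norm_exp]; simp

lemma integrable_radialStableFourier {d : ℕ} (hd : 1 ≤ d) {α : ℝ} (hα : 0 < α) (x : Ed d) {V : ℂ}
    (hV : 0 < V.re) : Integrable (fun z : Ed d => Complex.exp (-(Complex.I * (⟪x, z⟫ : ℂ))) *
      Complex.exp (V * ((-(‖z‖ ^ α) : ℝ) : ℂ))) := by
  refine (integrable_exp_neg_mul_norm_rpow hd hα hV).mono'
    (Measurable.aestronglyMeasurable (by fun_prop)) (Eventually.of_forall fun z => ?_)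
  rw [norm_mul, norm_cexp_neg_I_mul, one_mul, Complex.norm_exp, Complex.re_mul_ofReal, mul_neg]

/-- The Gaussian mixture formula for `radialStableFourier` at positive real parameters. -/
lemma radialStableFourier_ofReal {d : ℕ} (hd : 1 ≤ d) {α : ℝ} (hα : 0 < α) (ν : Measure ℝ)
    [IsProbabilityMeasure ν] (hpos : ∀ᵐ s ∂ν, 0 < s)
    (hL : ∀ t : ℝ, 0 ≤ t → ∫ s, Real.exp (-(t * s)) ∂ν = Real.exp (-(t ^ (α / 2))))
    (x : Ed d) {v : ℝ} (hv : 0 < v) :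
    radialStableFourier d α x v =
      ((Real.pi ^ ((d : ℝ) / 2) * v ^ (-((d : ℝ) / α)) : ℝ) : ℂ) *
        ∫ s, ((s ^ (-(d : ℝ) / 2) : ℝ) : ℂ) *
          Complex.exp (((-(‖x‖ ^ 2 / 4 * v ^ (-(2 / α))) : ℝ) : ℂ) * ((s⁻¹ : ℝ) : ℂ)) ∂ν := by
  set c : ℝ := v ^ (2 / α) with hc
  have hc0 : 0 < c := Real.rpow_pos_of_pos hv _
  have hcα : c ^ (α / 2) = v := by
    rw [hc, ← Real.rpow_mul hv.le, show 2 / α * (α / 2) = 1 by field_simp, Real.rpow_one]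
  have hlap : ∀ z : Ed d, ∫ s, Real.exp (-(c * ‖z‖ ^ 2 * s)) ∂ν = Real.exp (-(v * ‖z‖ ^ α)) := by
    intro z
    rw [hL _ (by positivity), Real.mul_rpow hc0.le (by positivity), hcα, ← Real.rpow_natCast,
      ← Real.rpow_mul (norm_nonneg z)]
    congr 4
    push_cast; ring
  have hlapint : ∀ z : Ed d, Integrable (fun s => Real.exp (-(c * ‖z‖ ^ 2 * s))) ν := by
    intro z
    by_contra h
    have := hlap z
    rw [integral_undef h] at this
    exact (Real.exp_pos _).ne this
  have hprod : Integrable (Function.uncurry fun (z : Ed d) (s : ℝ) =>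
      Complex.exp (-(Complex.I * (⟪x, z⟫ : ℂ))) * ((Real.exp (-(c * ‖z‖ ^ 2 * s)) : ℝ) : ℂ))
      (volume.prod ν) := by
    have hm : Measurable (Function.uncurry fun (z : Ed d) (s : ℝ) =>
      Complex.exp (-(Complex.I * (⟪x, z⟫ : ℂ))) * ((Real.exp (-(c * ‖z‖ ^ 2 * s)) : ℝ) : ℂ)) := by
      unfold Function.uncurry
      fun_prop
    rw [integrable_prod_iff hm.aestronglyMeasurable]
    refine ⟨Eventually.of_forall fun z => ((hlapint z).ofReal (𝕜 := ℂ)).const_mul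
      (Complex.exp (-(Complex.I * (⟪x, z⟫ : ℂ)))), ?_⟩
    refine (integrable_exp_neg_mul_norm_rpow hd hα hv).congr (Eventually.of_forall fun z => ?_)
    simp only [Function.uncurry, norm_mul, norm_cexp_neg_I_mul, one_mul, Complex.norm_real,
      Real.norm_eq_abs, abs_of_pos (Real.exp_pos _)]
    exact (hlap z).symm
  have hgauss : ∀ s : ℝ, 0 < s → ∫ z : Ed d, Complex.exp (-(Complex.I * (⟪x, z⟫ : ℂ))) *
      ((Real.exp (-(c * ‖z‖ ^ 2 * s)) : ℝ) : ℂ) =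
      ((Real.pi ^ ((d : ℝ) / 2) * v ^ (-((d : ℝ) / α)) : ℝ) : ℂ) *
        (((s ^ (-(d : ℝ) / 2) : ℝ) : ℂ) *
          Complex.exp (((-(‖x‖ ^ 2 / 4 * v ^ (-(2 / α))) : ℝ) : ℂ) * ((s⁻¹ : ℝ) : ℂ))) := by
    intro s hs
    have hcs : 0 < c * s := by positivity
    have h := GaussianFourier.integral_cexp_neg_mul_sq_norm_add (V := Ed d) (b := ((c * s : ℝ) : ℂ))
      (by rw [Complex.ofReal_re]; exact hcs) (-Complex.I) x
    have e1 : ∀ z : Ed d, Complex.exp (-(Complex.I * (⟪x, z⟫ : ℂ))) *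
        ((Real.exp (-(c * ‖z‖ ^ 2 * s)) : ℝ) : ℂ) =
        Complex.exp (-((c * s : ℝ) : ℂ) * (‖z‖ : ℂ) ^ 2 + -Complex.I * (⟪x, z⟫ : ℂ)) := by
      intro z
      rw [Complex.ofReal_exp, ← Complex.exp_add]
      push_cast; congr 1; ring
    simp_rw [e1]
    rw [h, finrank_euclideanSpace, Fintype.card_fin]
    have e2 : ((Real.pi : ℂ) / ((c * s : ℝ) : ℂ)) ^ ((d : ℂ) / 2) =
        (((Real.pi ^ ((d : ℝ) / 2) * v ^ (-((d : ℝ) / α)) * s ^ (-(d : ℝ) / 2)) : ℝ) : ℂ) := by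
      have : Real.pi ^ ((d : ℝ) / 2) * v ^ (-((d : ℝ) / α)) * s ^ (-(d : ℝ) / 2) =
          (Real.pi / (c * s)) ^ ((d : ℝ) / 2) := by
        rw [Real.div_rpow Real.pi_pos.le hcs.le, Real.mul_rpow hc0.le hs.le, hc,
          ← Real.rpow_mul hv.le, neg_div, Real.rpow_neg hv.le, Real.rpow_neg hs.le,
          show 2 / α * ((d : ℝ) / 2) = d / α by field_simp]
        field_simp
      rw [this, Complex.ofReal_cpow (by positivity)]
      push_cast; rfl
    rw [e2, Complex.ofReal_mul, mul_assoc]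
    congr 3
    rw [Real.rpow_neg hv.le, ← hc]
    push_cast
    have : (c : ℂ) ≠ 0 := by exact_mod_cast hc0.ne'
    have : (s : ℂ) ≠ 0 := by exact_mod_cast hs.ne'
    field_simp
    rw [Complex.I_sq]; ring
  calc radialStableFourier d α x v
      = ∫ z : Ed d, (∫ s, Complex.exp (-(Complex.I * (⟪x, z⟫ : ℂ))) *
          ((Real.exp (-(c * ‖z‖ ^ 2 * s)) : ℝ) : ℂ) ∂ν) := by
        refine integral_congr_ae (Eventually.of_forall fun z => ?_)
        simp only
        rw [integral_const_mul, integral_complex_ofReal, hlap z]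
        push_cast; congr 2; ring
    _ = ∫ s, (∫ z : Ed d, Complex.exp (-(Complex.I * (⟪x, z⟫ : ℂ))) *
          ((Real.exp (-(c * ‖z‖ ^ 2 * s)) : ℝ) : ℂ)) ∂ν := integral_integral_swap hprod
    _ = _ := by
        rw [← integral_const_mul]
        exact integral_congr_ae (hpos.mono fun s hs => hgauss s hs)

/-- The Gaussian mixture formula for `radialStableFourier`, extended to the right half-plane by
analytic continuation. -/
lemma radialStableFourier_eq {d : ℕ} (hd : 1 ≤ d) {α : ℝ} (hα : 1 < α) (ν : Measure ℝ)
    [IsProbabilityMeasure ν] (hpos : ∀ᵐ s ∂ν, 0 < s)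
    (hL : ∀ t : ℝ, 0 ≤ t → ∫ s, Real.exp (-(t * s)) ∂ν = Real.exp (-(t ^ (α / 2))))
    (x : Ed d) {V : ℂ} (hV : 0 < V.re) :
    radialStableFourier d α x V = ((Real.pi ^ ((d : ℝ) / 2) : ℝ) : ℂ) *
      (V ^ ((-((d : ℝ) / α) : ℝ) : ℂ) *
        ∫ s, ((s ^ (-(d : ℝ) / 2) : ℝ) : ℂ) *
          Complex.exp (-(((‖x‖ ^ 2 : ℝ) : ℂ) /
            (4 * V ^ (((2 / α : ℝ)) : ℂ) * (s : ℂ)))) ∂ν) := by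
  have hα0 : 0 < α := by linarith
  set U : Set ℂ := {w | 0 < w.re} with hU
  have hUo : IsOpen U := isOpen_lt continuous_const Complex.continuous_re
  have hUc : IsPreconnected U := (convex_halfSpace_re_gt 0).isPreconnected
  set F : ℂ → ℂ := fun w => ∫ s, ((s ^ (-(d : ℝ) / 2) : ℝ) : ℂ) *
    Complex.exp (w * ((s⁻¹ : ℝ) : ℂ)) ∂ν with hF
  have hFd : Differentiable ℂ F := by
    rw [← differentiableOn_univ]
    exact differentiableOn_integral_mul_cexp (X := fun s : ℝ => s⁻¹)
      (Measurable.aestronglyMeasurable (by fun_prop)) measurable_inv isOpen_univ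
      fun w _ => integrable_rpow_mul_cexp_inv_of_laplace (by linarith) ν hpos hL d w
  set R : ℂ → ℂ := fun w => ((Real.pi ^ ((d : ℝ) / 2) : ℝ) : ℂ) *
      (w ^ ((-((d : ℝ) / α) : ℝ) : ℂ) *
        F (-(((‖x‖ ^ 2 : ℝ) : ℂ) / 4 * w ^ ((-(2 / α) : ℝ) : ℂ)))) with hR
  have hpow : ∀ e : ℂ, DifferentiableOn ℂ (fun w : ℂ => w ^ e) U := by
    intro e w hw
    exact ((hasDerivAt_id w).cpow_const
      (Or.inl hw : w ∈ Complex.slitPlane)).differentiableAt.differentiableWithinAt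
  have hRd : DifferentiableOn ℂ R U :=
    ((hpow _).mul (hFd.comp_differentiableOn ((hpow _).const_mul _).neg)).const_mul _
  have hJd : DifferentiableOn ℂ (radialStableFourier d α x) U :=
    differentiableOn_integral_mul_cexp (X := fun z : Ed d => -(‖z‖ ^ α))
      (Measurable.aestronglyMeasurable (by fun_prop)) (by fun_prop) hUo
      fun w hw => integrable_radialStableFourier hd hα0 x hw
  have hreal : ∀ v : ℝ, 0 < v → radialStableFourier d α x v = R v := by
    intro v hv
    rw [radialStableFourier_ofReal hd hα0 ν hpos hL x hv]
    simp only [hR, hF]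
    rw [← Complex.ofReal_cpow hv.le, ← Complex.ofReal_cpow hv.le]
    push_cast
    ring
  have hfreq : ∃ᶠ w in 𝓝[≠] (1 : ℂ), radialStableFourier d α x w = R w := by
    have ht : Tendsto (fun v : ℝ => (v : ℂ)) (𝓝[>] 1) (𝓝[≠] (1 : ℂ)) := by
      refine tendsto_nhdsWithin_iff.2 ⟨?_, ?_⟩
      · exact (Complex.continuous_ofReal.tendsto' 1 1 (by simp)).mono_left nhdsWithin_le_nhds
      · filter_upwards [self_mem_nhdsWithin] with v hv
        have : (1 : ℝ) < v := hv
        simpa using this.ne'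
    refine ht.frequently (Eventually.frequently ?_)
    filter_upwards [self_mem_nhdsWithin] with v hv
    exact hreal v (by have : (1 : ℝ) < v := hv; linarith)
  have heq := (hJd.analyticOnNhd hUo).eqOn_of_preconnected_of_frequently_eq
    (hRd.analyticOnNhd hUo) hUc (show (1 : ℂ) ∈ U by simp [hU]) hfreq
  rw [heq hV]
  simp only [hR, hF]
  congr 3
  funext s
  congr 2
  rw [Complex.ofReal_neg (2 / α), Complex.cpow_neg]
  push_cast
  simp only [div_eq_mul_inv, mul_inv]
  ring

section Inversion

lemma norm_cexp_neg_inv_mul_sq_le {c : ℝ} (hc : 0 < c) (r : ℝ) :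
    ‖Complex.exp (-((c⁻¹ : ℝ) : ℂ) * (r : ℂ) ^ 2)‖ ≤ 1 := by
  rw [Complex.norm_exp, Real.exp_le_one_iff]
  have : -((c⁻¹ : ℝ) : ℂ) * (r : ℂ) ^ 2 = ((-(c⁻¹ * r ^ 2) : ℝ) : ℂ) := by push_cast; ring
  rw [this, Complex.ofReal_re]
  have : 0 ≤ c⁻¹ * r ^ 2 := by positivity
  linarith

variable {E : Type*} [NormedAddCommGroup E] [InnerProductSpace ℝ E]

/-- The density of the Gaussian approximate identity. -/
def gaussKernel (E : Type*) [NormedAddCommGroup E] [InnerProductSpace ℝ E] (c : ℝ) (y : E) : ℝ :=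
  (Real.pi * c) ^ ((Module.finrank ℝ E : ℝ) / 2) * Real.exp (-(Real.pi ^ 2 * c) * ‖y‖ ^ 2)

@[fun_prop]
lemma continuous_gaussKernel (c : ℝ) : Continuous (gaussKernel E c) := by
  unfold gaussKernel; fun_prop

lemma gaussKernel_nonneg {c : ℝ} (hc : 0 < c) (y : E) : 0 ≤ gaussKernel E c y := by
  unfold gaussKernel; positivity

lemma gaussKernel_le {c : ℝ} (hc : 0 < c) (y : E) :
    gaussKernel E c y ≤ (Real.pi * c) ^ ((Module.finrank ℝ E : ℝ) / 2) := by
  unfold gaussKernel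
  refine mul_le_of_le_one_right (by positivity) (Real.exp_le_one_iff.2 ?_)
  have : 0 ≤ Real.pi ^ 2 * c * ‖y‖ ^ 2 := by positivity
  linarith

lemma ofReal_gaussKernel {c : ℝ} (hc : 0 < c) (y : E) :
    (gaussKernel E c y : ℂ) = ((Real.pi * c : ℂ)) ^ (Module.finrank ℝ E / 2 : ℂ) *
      Complex.exp (-Real.pi ^ 2 * c * ‖y‖ ^ 2) := by
  unfold gaussKernel
  rw [Complex.ofReal_mul, Complex.ofReal_cpow (by positivity)]
  push_cast
  congr 2
  ring

variable [MeasurableSpace E] [BorelSpace E] [FiniteDimensional ℝ E]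

/-- The inverse Fourier transform of the characteristic function of `μ`. -/
def charFunInv (μ : Measure E) (x : E) : ℂ :=
  (((2 * Real.pi) ^ Module.finrank ℝ E)⁻¹ : ℝ) *
    ∫ z : E, Complex.exp (-(Complex.I * (⟪x, z⟫ : ℂ))) * charFun μ z

lemma continuous_charFunInv {μ : Measure E} (hφ : Integrable (charFun μ)) :
    Continuous (charFunInv μ) := by
  refine continuous_const.mul (continuous_of_dominated (bound := fun z => ‖charFun μ z‖)
    (fun x => ?_) (fun x => Eventually.of_forall fun z => ?_) hφ.norm
    (Eventually.of_forall fun z => by fun_prop))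
  · exact (Continuous.aestronglyMeasurable (by fun_prop)).mul hφ.aestronglyMeasurable
  · rw [norm_mul, norm_cexp_neg_I_mul, one_mul]

lemma charFunInv_eq (μ : Measure E) (x : E) :
    charFunInv μ x = ∫ z : E, Complex.exp (-(Complex.I * ((2 * Real.pi * ⟪x, z⟫ : ℝ) : ℂ))) *
      charFun μ ((2 * Real.pi) • z) := by
  have h := Measure.integral_comp_smul (volume : Measure E)
    (fun z => Complex.exp (-(Complex.I * (⟪x, z⟫ : ℂ))) * charFun μ z) (2 * Real.pi)
  simp only [inner_smul_right] at h
  rw [h, charFunInv, abs_of_pos (by positivity)]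
  simp

lemma integral_gaussKernel {c : ℝ} (hc : 0 < c) : ∫ y : E, gaussKernel E c y = 1 := by
  unfold gaussKernel
  rw [integral_const_mul, GaussianFourier.integral_rexp_neg_mul_sq_norm (by positivity),
    ← Real.mul_rpow (by positivity) (by positivity)]
  rw [show Real.pi * c * (Real.pi / (Real.pi ^ 2 * c)) = 1 by field_simp, Real.one_rpow]

lemma integrable_gaussKernel {c : ℝ} (hc : 0 < c) : Integrable (gaussKernel E c) := by
  by_contra h
  have := integral_gaussKernel (E := E) hc
  rw [integral_undef h] at this
  exact zero_ne_one this

lemma gaussKernel_eq_integral {c : ℝ} (hc : 0 < c) (y : E) :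
    (gaussKernel E c y : ℂ) =
      ∫ z : E, Complex.exp (-((c⁻¹ : ℝ) : ℂ) * ‖z‖ ^ 2 + 2 * Real.pi * Complex.I * (⟪y, z⟫ : ℂ)) := by
  rw [GaussianFourier.integral_cexp_neg_mul_sq_norm_add
    (by rw [Complex.ofReal_re]; positivity), ofReal_gaussKernel hc]
  have : (c : ℂ) ≠ 0 := by exact_mod_cast hc.ne'
  congr 2
  · push_cast; field_simp
  · push_cast
    rw [mul_pow, Complex.I_sq]
    field_simp
    ring

lemma integral_gaussKernel_sub (μ : Measure E) [IsProbabilityMeasure μ] {c : ℝ} (hc : 0 < c)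
    (w : E) : ∫ x, (gaussKernel E c (x - w) : ℂ) ∂μ =
      ∫ z : E, Complex.exp (-((c⁻¹ : ℝ) : ℂ) * ‖z‖ ^ 2) *
        (Complex.exp (-(Complex.I * ((2 * Real.pi * ⟪w, z⟫ : ℝ) : ℂ))) *
          charFun μ ((2 * Real.pi) • z)) := by
  simp_rw [gaussKernel_eq_integral hc]
  rw [integral_integral_swap]
  · refine integral_congr_ae (Eventually.of_forall fun z => ?_)
    simp only [charFun_apply]
    rw [← mul_assoc, ← integral_const_mul]
    refine integral_congr_ae (Eventually.of_forall fun x => ?_)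
    simp only
    rw [← Complex.exp_add, ← Complex.exp_add, inner_sub_left, inner_smul_right]
    push_cast
    congr 1; ring
  · have hg : Integrable (fun p : E × E => Complex.exp (-((c⁻¹ : ℝ) : ℂ) * ‖p.2‖ ^ 2))
        (μ.prod volume) := by
      have : Integrable (fun z : E => Complex.exp (-((c⁻¹ : ℝ) : ℂ) * ‖z‖ ^ 2)) := by
        simpa using GaussianFourier.integrable_cexp_neg_mul_sq_norm_add (V := E)
          (b := ((c⁻¹ : ℝ) : ℂ)) (by rw [Complex.ofReal_re]; positivity) 0 0
      exact this.comp_snd μ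
    refine hg.mono (Continuous.aestronglyMeasurable ?_) (Eventually.of_forall fun p => ?_)
    · unfold Function.uncurry; fun_prop
    · apply le_of_eq
      simp only [Function.uncurry, Complex.exp_add, norm_mul]
      rw [show (2 * Real.pi * Complex.I * (⟪p.1 - w, p.2⟫ : ℂ)) =
        -(Complex.I * ((-(2 * Real.pi * ⟪p.1 - w, p.2⟫) : ℝ) : ℂ)) by push_cast; ring,
        norm_cexp_neg_I_mul, mul_one]

lemma integrable_charFun_comp_smul {μ : Measure E} (hφ : Integrable (charFun μ)) :
    Integrable (fun z : E => charFun μ ((2 * Real.pi) • z)) :=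
  hφ.comp_smul (by positivity)

lemma norm_integral_gaussKernel_sub_le {μ : Measure E} [IsProbabilityMeasure μ]
    (hφ : Integrable (charFun μ)) {c : ℝ} (hc : 0 < c) (w : E) :
    ‖∫ x, (gaussKernel E c (x - w) : ℂ) ∂μ‖ ≤ ∫ z : E, ‖charFun μ ((2 * Real.pi) • z)‖ := by
  rw [integral_gaussKernel_sub μ hc]
  refine norm_integral_le_of_norm_le (integrable_charFun_comp_smul hφ).norm
    (Eventually.of_forall fun z => ?_)
  rw [norm_mul, norm_mul, norm_cexp_neg_I_mul, one_mul]
  exact mul_le_of_le_one_left (norm_nonneg _) (norm_cexp_neg_inv_mul_sq_le hc ‖z‖)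

lemma tendsto_integral_gaussKernel_sub {μ : Measure E} [IsProbabilityMeasure μ]
    (hφ : Integrable (charFun μ)) (w : E) :
    Tendsto (fun c : ℝ => ∫ x, (gaussKernel E c (x - w) : ℂ) ∂μ) atTop (𝓝 (charFunInv μ w)) := by
  have hφ' := integrable_charFun_comp_smul hφ
  have hi : Integrable (fun z : E => Complex.exp (-(Complex.I *
      ((2 * Real.pi * ⟪w, z⟫ : ℝ) : ℂ))) * charFun μ ((2 * Real.pi) • z)) := by
    refine hφ'.mono ((Continuous.aestronglyMeasurable (by fun_prop)).mul
      hφ'.aestronglyMeasurable) (Eventually.of_forall fun z => ?_)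
    rw [norm_mul, norm_cexp_neg_I_mul, one_mul]
  rw [charFunInv_eq]
  refine (Real.tendsto_integral_cexp_sq_smul hi).congr' ?_
  filter_upwards [eventually_gt_atTop 0] with c hc
  rw [integral_gaussKernel_sub μ hc]
  simp [smul_eq_mul]

lemma charFunInv_nonneg {μ : Measure E} [IsProbabilityMeasure μ]
    (hφ : Integrable (charFun μ)) (w : E) :
    0 ≤ (charFunInv μ w).re ∧ (charFunInv μ w).im = 0 := by
  have h := tendsto_integral_gaussKernel_sub hφ w
  have hev : ∀ᶠ c : ℝ in atTop, ∫ x, (gaussKernel E c (x - w) : ℂ) ∂μ ∈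
      {z : ℂ | 0 ≤ z.re ∧ z.im = 0} := by
    filter_upwards [eventually_gt_atTop 0] with c hc
    rw [integral_complex_ofReal]
    exact ⟨by rw [Complex.ofReal_re]; exact integral_nonneg fun x => gaussKernel_nonneg hc _,
      Complex.ofReal_im _⟩
  change charFunInv μ w ∈ {z : ℂ | 0 ≤ z.re ∧ z.im = 0}
  refine IsClosed.mem_of_tendsto ?_ h hev
  exact (isClosed_le continuous_const Complex.continuous_re).inter
    (isClosed_eq Complex.continuous_im continuous_const)

lemma norm_integral_gaussKernel_mul_le {h : E → ℝ} {C : ℝ} (hC : ∀ x, ‖h x‖ ≤ C)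
    {c : ℝ} (hc : 0 < c) (x : E) :
    ‖∫ w, (gaussKernel E c (x - w) : ℂ) * (h w : ℂ)‖ ≤ C := by
  have hi : Integrable (fun w => gaussKernel E c (x - w)) := (integrable_gaussKernel hc).comp_sub_left x
  calc _ ≤ ∫ w, gaussKernel E c (x - w) * C := by
        refine norm_integral_le_of_norm_le (hi.mul_const C) (Eventually.of_forall fun w => ?_)
        rw [norm_mul, Complex.norm_real, Complex.norm_real, Real.norm_eq_abs,
          abs_of_nonneg (gaussKernel_nonneg hc _)]
        exact mul_le_mul_of_nonneg_left (hC w) (gaussKernel_nonneg hc _)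
    _ = C := by
        rw [integral_mul_const, integral_sub_left_eq_self (gaussKernel E c) volume x,
          integral_gaussKernel hc, one_mul]

/-- **Fourier inversion** for probability measures with integrable characteristic function,
tested against compactly supported continuous functions. -/
lemma integral_mul_charFunInv {μ : Measure E} [IsProbabilityMeasure μ]
    (hφ : Integrable (charFun μ)) {h : E → ℝ} (hh : Continuous h) (hs : HasCompactSupport h) :
    ∫ w, (h w : ℂ) * charFunInv μ w = ∫ x, (h x : ℂ) ∂μ := by
  obtain ⟨C, hC⟩ := hs.exists_bound_of_continuous hh
  have hi : Integrable (fun w => (h w : ℂ)) := (hh.integrable_of_hasCompactSupport hs).ofReal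
  have hl : Tendsto (fun c : ℝ => ∫ w, (h w : ℂ) * ∫ x, (gaussKernel E c (x - w) : ℂ) ∂μ) atTop
      (𝓝 (∫ w, (h w : ℂ) * charFunInv μ w)) := by
    refine tendsto_integral_filter_of_dominated_convergence
      (fun w => ‖(h w : ℂ)‖ * ∫ z : E, ‖charFun μ ((2 * Real.pi) • z)‖) ?_ ?_
      (hi.norm.mul_const _) ?_
    · refine Eventually.of_forall fun c => hi.aestronglyMeasurable.mul ?_
      have : StronglyMeasurable (Function.uncurry fun w x : E => (gaussKernel E c (x - w) : ℂ)) :=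
        Continuous.stronglyMeasurable (by unfold Function.uncurry; fun_prop)
      exact this.integral_prod_right.aestronglyMeasurable
    · filter_upwards [eventually_gt_atTop 0] with c hc
      refine Eventually.of_forall fun w => ?_
      rw [norm_mul]
      gcongr
      exact norm_integral_gaussKernel_sub_le hφ hc w
    · exact Eventually.of_forall fun w => (tendsto_integral_gaussKernel_sub hφ w).const_mul _
  have hr : Tendsto (fun c : ℝ => ∫ x, (∫ w, (gaussKernel E c (x - w) : ℂ) * (h w : ℂ)) ∂μ) atTop
      (𝓝 (∫ x, (h x : ℂ) ∂μ)) := by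
    refine tendsto_integral_filter_of_dominated_convergence (fun _ => C) ?_ ?_
      (integrable_const _) ?_
    · refine Eventually.of_forall fun c => ?_
      have : StronglyMeasurable (Function.uncurry fun x w : E =>
          (gaussKernel E c (x - w) : ℂ) * (h w : ℂ)) :=
        Continuous.stronglyMeasurable (by unfold Function.uncurry; fun_prop)
      exact this.integral_prod_right.aestronglyMeasurable
    · filter_upwards [eventually_gt_atTop 0] with c hc
      exact Eventually.of_forall fun x => norm_integral_gaussKernel_mul_le hC hc x
    · refine Eventually.of_forall fun x => ?_
      refine (Real.tendsto_integral_gaussian_smul' hi (v := x) (by fun_prop)).congr' ?_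
      filter_upwards [eventually_gt_atTop 0] with c hc
      simp_rw [ofReal_gaussKernel hc, smul_eq_mul]
  refine tendsto_nhds_unique hl (hr.congr' ?_)
  filter_upwards [eventually_gt_atTop 0] with c hc
  rw [integral_integral_swap]
  · refine integral_congr_ae (Eventually.of_forall fun w => ?_)
    simp only
    rw [integral_mul_const, mul_comm]
  · have : Integrable (fun p : E × E => (h p.2 : ℂ)) (μ.prod volume) := hi.comp_snd μ
    refine (this.norm.const_mul ((Real.pi * c) ^ ((Module.finrank ℝ E : ℝ) / 2))).mono'
      (Continuous.aestronglyMeasurable (by unfold Function.uncurry; fun_prop))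
      (Eventually.of_forall fun p => ?_)
    simp only [Function.uncurry]
    rw [norm_mul, Complex.norm_real, Real.norm_eq_abs, abs_of_nonneg (gaussKernel_nonneg hc _)]
    gcongr
    exact gaussKernel_le hc _

/-- A probability measure with integrable characteristic function has density `charFunInv`. -/
lemma eq_withDensity_charFunInv {μ : Measure E} [IsProbabilityMeasure μ]
    (hφ : Integrable (charFun μ)) :
    μ = volume.withDensity (fun x => ENNReal.ofReal (charFunInv μ x).re) := by
  have hc : Continuous (fun x => (charFunInv μ x).re) :=
    Complex.continuous_re.comp (continuous_charFunInv hφ)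
  have := IsLocallyFiniteMeasure.withDensity_ofReal (μ := (volume : Measure E)) hc
  refine Measure.ext_of_integral_eq_on_compactlySupported fun h => ?_
  have h1 := integral_mul_charFunInv hφ (h := ⇑h) (map_continuous h) h.hasCompactSupport
  rw [integral_complex_ofReal] at h1
  have h2 : ∀ w, (h w : ℂ) * charFunInv μ w = ((h w * (charFunInv μ w).re : ℝ) : ℂ) := by
    intro w
    apply Complex.ext <;> simp [(charFunInv_nonneg hφ w).2]
  rw [integral_congr_ae (Eventually.of_forall h2), integral_complex_ofReal] at h1
  rw [← Complex.ofReal_inj.1 h1, integral_withDensity_eq_integral_toReal_smul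
    hc.measurable.ennreal_ofReal (Eventually.of_forall fun x => ENNReal.ofReal_lt_top)]
  refine integral_congr_ae (Eventually.of_forall fun x => ?_)
  simp only [smul_eq_mul]
  rw [ENNReal.toReal_ofReal (charFunInv_nonneg hφ x).1, mul_comm]

end Inversion

lemma _root_.Real.measurable_sign : Measurable Real.sign := by
  unfold Real.sign
  exact Measurable.ite measurableSet_Iio measurable_const
    (Measurable.ite measurableSet_Ioi measurable_const measurable_const)

lemma _root_.Real.sign_mul_of_pos {a : ℝ} (ha : 0 < a) (x : ℝ) :
    Real.sign (a * x) = Real.sign x := by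
  simp [Real.sign, mul_neg_iff, ha, not_lt_of_gt ha]

lemma charExp_zero (d : ℕ) {α : ℝ} (hα : 0 < α) (Λ : Measure (Sph d)) :
    charExp d α Λ 0 = 0 := by
  simp [charExp, Real.zero_rpow hα.ne']

/-- The characteristic exponent is positively homogeneous of degree `α`. -/
lemma charExp_smul (d : ℕ) {α : ℝ} (Λ : Measure (Sph d)) {ρ : ℝ} (hρ : 0 < ρ) (z : Ed d) :
    charExp d α Λ (ρ • z) = ((ρ ^ α : ℝ) : ℂ) * charExp d α Λ z := by
  unfold charExp
  rw [← integral_const_mul]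
  refine integral_congr_ae (Eventually.of_forall fun v => ?_)
  simp only [real_inner_smul_left, abs_mul, abs_of_pos hρ]
  rw [Real.mul_rpow hρ.le (abs_nonneg _), Real.sign_mul_of_pos hρ]
  push_cast
  ring

lemma norm_sub_I_mul_sign_le (t x : ℝ) :
    ‖(1 - Complex.I * (t : ℂ) * (Real.sign x : ℂ) : ℂ)‖ ≤ 1 + |t| := by
  refine (norm_sub_le _ _).trans ?_
  rw [norm_one, norm_mul, norm_mul, Complex.norm_I, one_mul, Complex.norm_real, Complex.norm_real,
    Real.norm_eq_abs, Real.norm_eq_abs]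
  gcongr
  refine mul_le_of_le_one_right (abs_nonneg _) ?_
  rcases Real.sign_apply_eq x with h | h | h <;> simp [h]

lemma integrable_charExp (d : ℕ) {α : ℝ} (hα : 0 < α) (Λ : Measure (Sph d)) [IsFiniteMeasure Λ]
    (z : Ed d) :
    Integrable (fun v : Sph d => ((|⟪z, (v : Ed d)⟫| ^ α : ℝ) : ℂ) *
      (1 - Complex.I * (Real.tan (Real.pi * α / 2) : ℂ) *
        (Real.sign ⟪z, (v : Ed d)⟫ : ℂ))) Λ := by
  have hi : Measurable fun v : Sph d => ⟪z, (v : Ed d)⟫ := by fun_prop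
  refine Integrable.of_bound (C := ‖z‖ ^ α * (1 + |Real.tan (Real.pi * α / 2)|)) ?_
    (Eventually.of_forall fun v => ?_)
  · refine Measurable.aestronglyMeasurable ?_
    have := Real.measurable_sign.comp hi
    simp only [Function.comp_def] at this
    exact (Complex.measurable_ofReal.comp ((hi.abs).pow_const α)).mul
      (measurable_const.sub (measurable_const.mul (Complex.measurable_ofReal.comp this)))
  · rw [norm_mul]
    gcongr
    · rw [Complex.norm_real, Real.norm_eq_abs, abs_of_nonneg (by positivity)]
      gcongr
      simpa using abs_real_inner_le_norm z (v : Ed d)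
    · exact norm_sub_I_mul_sign_le _ _

lemma re_charExp (d : ℕ) {α : ℝ} (hα : 0 < α) (Λ : Measure (Sph d)) [IsFiniteMeasure Λ]
    (z : Ed d) : (charExp d α Λ z).re = ∫ v, |⟪z, (v : Ed d)⟫| ^ α ∂Λ := by
  unfold charExp
  have := integral_re (integrable_charExp d hα Λ z)
  simp only [RCLike.re_eq_complex_re] at this
  rw [← this]
  refine integral_congr_ae (Eventually.of_forall fun v => ?_)
  simp [Complex.mul_re, -Complex.ofReal_tan]

lemma charFun_eq_cexp {d : ℕ} {α : ℝ} {Λ : Measure (Sph d)} {μ : Measure (Ed d)}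
    (hμ : IsStableChar d α Λ μ) (z : Ed d) :
    charFun μ z = Complex.exp (-charExp d α Λ z) := by
  rw [← hμ z, charFun_apply]
  refine integral_congr_ae (Eventually.of_forall fun x => ?_)
  simp only
  rw [real_inner_comm, mul_comm]

lemma norm_charFun_eq {d : ℕ} {α : ℝ} {Λ : Measure (Sph d)} {μ : Measure (Ed d)}
    (hμ : IsStableChar d α Λ μ) (z : Ed d) :
    ‖charFun μ z‖ = Real.exp (-(charExp d α Λ z).re) := by
  rw [charFun_eq_cexp hμ, Complex.norm_exp, Complex.neg_re]

/-- If the real part of the exponent vanishes at `u`, the marginal along `u` is a point mass. -/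
lemma map_inner_eq_dirac {d : ℕ} {α : ℝ} (hα : 0 < α) {Λ : Measure (Sph d)} [IsFiniteMeasure Λ]
    {μ : Measure (Ed d)} [IsProbabilityMeasure μ] (hμ : IsStableChar d α Λ μ) {u : Ed d}
    (hu : (charExp d α Λ u).re = 0) :
    μ.map (fun x => ⟪u, x⟫) = Measure.dirac 0 := by
  have hm : Measurable fun x : Ed d => ⟪u, x⟫ := by fun_prop
  have := Measure.isProbabilityMeasure_map (μ := μ) hm.aemeasurable
  rw [re_charExp d hα] at hu
  have hint : Integrable (fun v : Sph d => |⟪u, (v : Ed d)⟫| ^ α) Λ := by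
    refine Integrable.of_bound (C := ‖u‖ ^ α) ?_ (Eventually.of_forall fun v => ?_)
    · exact Measurable.aestronglyMeasurable (by fun_prop)
    · rw [Real.norm_eq_abs, abs_of_nonneg (by positivity)]
      gcongr
      simpa using abs_real_inner_le_norm u (v : Ed d)
  rw [integral_eq_zero_iff_of_nonneg (fun v => by positivity) hint] at hu
  have hz : ∀ t : ℝ, charExp d α Λ (t • u) = 0 := by
    intro t
    unfold charExp
    rw [integral_eq_zero_of_ae]
    filter_upwards [hu] with v hv
    simp only [Pi.zero_apply, Real.rpow_eq_zero (abs_nonneg _) hα.ne', abs_eq_zero] at hv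
    simp [real_inner_smul_left, hv, Real.zero_rpow hα.ne']
  refine Measure.ext_of_charFun (funext fun t => ?_)
  rw [charFun_dirac, charFun_apply, integral_map hm.aemeasurable (by fun_prop)]
  have := hμ (t • u)
  rw [hz t, neg_zero, Complex.exp_zero] at this
  simp only [inner_zero_left, Complex.ofReal_zero, zero_mul, Complex.exp_zero]
  rw [← this]
  refine integral_congr_ae (Eventually.of_forall fun x => ?_)
  simp only [real_inner_smul_left]
  congr 1
  simp
  ring

lemma re_charExp_pos {d : ℕ} {α : ℝ} (hα : 0 < α) {Λ : Measure (Sph d)} [IsFiniteMeasure Λ]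
    {μ : Measure (Ed d)} [IsProbabilityMeasure μ] (hμ : IsStableChar d α Λ μ)
    (hnd : Nondegenerate d μ) {u : Ed d} (hu : u ≠ 0) : 0 < (charExp d α Λ u).re := by
  refine lt_of_le_of_ne ?_ fun h => ?_
  · rw [re_charExp d hα]
    exact integral_nonneg fun v => by positivity
  have hd := map_inner_eq_dirac hα hμ h.symm
  have hm : Measurable fun x : Ed d => ⟪u, x⟫ := by fun_prop
  have hW : (ℝ ∙ u)ᗮ ≠ ⊤ := by
    intro h
    rw [Submodule.orthogonal_eq_top_iff, Submodule.span_singleton_eq_bot] at h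
    exact hu h
  have h1 := hnd 0 _ hW
  have h2 : (fun x : Ed d => 0 + x) '' (((ℝ ∙ u)ᗮ : Submodule ℝ (Ed d)) : Set (Ed d)) =
      (fun x => ⟪u, x⟫) ⁻¹' {0} := by
    ext x
    simp [Submodule.mem_orthogonal_singleton_iff_inner_right]
  rw [h2, ← Measure.map_apply hm (measurableSet_singleton 0), hd] at h1
  simp at h1

/-- The real part of `V` is bounded away from zero on the sphere. -/
lemma exists_le_re_Vfun {d : ℕ} {α : ℝ} (hα : 0 < α) {Λ : Measure (Sph d)} [IsFiniteMeasure Λ]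
    {μ : Measure (Ed d)} [IsProbabilityMeasure μ] (hμ : IsStableChar d α Λ μ)
    (hnd : Nondegenerate d μ) : ∃ m : ℝ, 0 < m ∧ ∀ u : Sph d, m ≤ (Vfun d α Λ u).re := by
  have hc : Continuous fun u : Sph d => (Vfun d α Λ u).re := by
    have : ∀ u : Sph d, (Vfun d α Λ u).re = -Real.log ‖charFun μ (u : Ed d)‖ := fun u => by
      rw [norm_charFun_eq hμ, Real.log_exp, neg_neg, Vfun]
    simp_rw [this]
    refine (Continuous.log ?_ fun u => ?_).neg
    · exact (continuous_charFun.comp continuous_subtype_val).norm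
    · rw [norm_charFun_eq hμ]
      exact (Real.exp_pos _).ne'
  rcases isEmpty_or_nonempty (Sph d) with he | he
  · exact ⟨1, one_pos, fun u => he.elim u⟩
  · obtain ⟨u₀, -, h₀⟩ := isCompact_univ.exists_isMinOn (s := (Set.univ : Set (Sph d)))
      Set.univ_nonempty hc.continuousOn
    exact ⟨_, re_charExp_pos hα hμ hnd (ne_zero_of_mem_unit_sphere u₀),
      fun u => h₀ (Set.mem_univ u)⟩

lemma norm_charFun_smul_le {d : ℕ} {α : ℝ} {Λ : Measure (Sph d)} {μ : Measure (Ed d)}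
    (hμ : IsStableChar d α Λ μ) {m : ℝ} (hm : ∀ u : Sph d, m ≤ (Vfun d α Λ u).re)
    {ρ : ℝ} (hρ : 0 < ρ) (u : Sph d) :
    ‖charFun μ (ρ • (u : Ed d))‖ ≤ Real.exp (-(m * ρ ^ α)) := by
  rw [norm_charFun_eq hμ, charExp_smul d Λ hρ, Complex.re_ofReal_mul, mul_comm m]
  gcongr
  exact hm u

lemma norm_charFun_le {d : ℕ} {α : ℝ} (hα : 0 < α) {Λ : Measure (Sph d)} {μ : Measure (Ed d)}
    (hμ : IsStableChar d α Λ μ) {m : ℝ} (hm : ∀ u : Sph d, m ≤ (Vfun d α Λ u).re) (z : Ed d) :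
    ‖charFun μ z‖ ≤ Real.exp (-(m * ‖z‖ ^ α)) := by
  rcases eq_or_ne z 0 with rfl | hz
  · rw [norm_charFun_eq hμ, charExp_zero d hα]
    simp [Real.zero_rpow hα.ne']
  · have h := norm_charFun_smul_le hμ hm (norm_pos_iff.2 hz)
      ⟨‖z‖⁻¹ • z, by simp [norm_smul, hz]⟩
    simpa [smul_smul, hz] using h

section Polar

variable {G : Type*} [NormedAddCommGroup G] {n : ℕ}

lemma integrable_volumeIoiPow_iff {f : ℝ → G} [NormedSpace ℝ G] :
    Integrable (fun y : Set.Ioi (0 : ℝ) => f y) (Measure.volumeIoiPow n) ↔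
      IntegrableOn (fun y => y ^ n • f y) (Set.Ioi 0) := by
  rw [integrableOn_iff_comap_subtypeVal measurableSet_Ioi, Function.comp_def, Measure.volumeIoiPow,
    integrable_withDensity_iff_integrable_smul', integrable_congr]
  · refine .of_forall ?_
    rintro ⟨x, hx : 0 < x⟩
    simp (disch := positivity) [ENNReal.toReal_ofReal]
  · fun_prop
  · simp

lemma integral_volumeIoiPow [NormedSpace ℝ G] (f : ℝ → G) :
    ∫ y : Set.Ioi (0 : ℝ), f y ∂(Measure.volumeIoiPow n) =
      ∫ y in Set.Ioi (0 : ℝ), y ^ n • f y := by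
  simp only [Measure.volumeIoiPow, ENNReal.ofReal]
  rw [integral_withDensity_eq_integral_smul,
    integral_subtype_comap measurableSet_Ioi fun a ↦ Real.toNNReal (a ^ n) • f a,
    setIntegral_congr_fun measurableSet_Ioi fun x hx ↦ ?_]
  · rw [NNReal.smul_def, Real.coe_toNNReal _ (pow_nonneg hx.out.le _)]
  · exact (measurable_subtype_coe.pow_const _).real_toNNReal

variable {d : ℕ}

lemma measurePreserving_polar (d : ℕ) :
    MeasurePreserving (homeomorphUnitSphereProd (Ed d))
      ((volume : Measure (Ed d)).comap (↑)) ((ωd d).prod (Measure.volumeIoiPow (d - 1))) := by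
  simpa [ωd] using (volume : Measure (Ed d)).measurePreserving_homeomorphUnitSphereProd

lemma homeomorphUnitSphereProd_smul (x : ({0}ᶜ : Set (Ed d))) :
    ((homeomorphUnitSphereProd (Ed d) x).2 : ℝ) • ((homeomorphUnitSphereProd (Ed d) x).1 : Ed d) =
      x := by
  have := (homeomorphUnitSphereProd (Ed d)).symm_apply_apply x
  rw [← homeomorphUnitSphereProd_symm_apply_coe, this]

/-- Integration in polar coordinates. -/
lemma integral_polar [NormedSpace ℝ G] (hd : 1 ≤ d) (F : Ed d → G) :
    ∫ z, F z = ∫ p : Sph d × Set.Ioi (0 : ℝ), F ((p.2 : ℝ) • (p.1 : Ed d))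
      ∂((ωd d).prod (Measure.volumeIoiPow (d - 1))) := by
  have : Nonempty (Fin d) := ⟨⟨0, hd⟩⟩
  rw [← (measurePreserving_polar d).integral_comp (Homeomorph.measurableEmbedding _)]
  simp_rw [homeomorphUnitSphereProd_smul]
  rw [integral_subtype_comap (measurableSet_singleton _).compl F, restrict_compl_singleton]

lemma integrable_polar (hd : 1 ≤ d) {F : Ed d → G} (hF : Integrable F) :
    Integrable (fun p : Sph d × Set.Ioi (0 : ℝ) => F ((p.2 : ℝ) • (p.1 : Ed d)))
      ((ωd d).prod (Measure.volumeIoiPow (d - 1))) := by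
  have : Nonempty (Fin d) := ⟨⟨0, hd⟩⟩
  rw [← (measurePreserving_polar d).integrable_comp_emb (Homeomorph.measurableEmbedding _)]
  simp_rw [Function.comp_def, homeomorphUnitSphereProd_smul]
  rw [← restrict_compl_singleton (μ := (volume : Measure (Ed d))) 0, ← IntegrableOn,
    integrableOn_iff_comap_subtypeVal (measurableSet_singleton _).compl] at hF
  exact hF

end Polar

instance (d : ℕ) : IsFiniteMeasure (ωd d) := by
  unfold ωd
  infer_instance

section Radial

variable {d : ℕ} {α : ℝ} {Λ : Measure (Sph d)} {μ : Measure (Ed d)}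

lemma integrable_charFun [IsProbabilityMeasure μ] (hd : 1 ≤ d) (hα : 0 < α)
    (hμ : IsStableChar d α Λ μ) {m : ℝ} (hm0 : 0 < m) (hm : ∀ u : Sph d, m ≤ (Vfun d α Λ u).re) :
    Integrable (charFun μ) :=
  (integrable_exp_neg_mul_norm_rpow hd hα hm0).mono'
    continuous_charFun.aestronglyMeasurable
    (Eventually.of_forall fun z => norm_charFun_le hα hμ hm z)

lemma norm_smul_sphere (ρ : Set.Ioi (0 : ℝ)) (u : Sph d) : ‖(ρ : ℝ) • (u : Ed d)‖ = ρ := by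
  rw [norm_smul, Real.norm_eq_abs, abs_of_pos ρ.2, norm_eq_of_mem_sphere, mul_one]

/-- Exchanging the two spherical variables turns the Fourier integrals of the radial functions
`exp (-V(v) |z| ^ α)` into that of the characteristic function. -/
lemma integral_radialStableFourier_Vfun [IsProbabilityMeasure μ] (hd : 1 ≤ d) (hα : 0 < α)
    (hμ : IsStableChar d α Λ μ) {m : ℝ} (hm0 : 0 < m) (hm : ∀ u : Sph d, m ≤ (Vfun d α Λ u).re)
    (r : ℝ) :
    ∫ v, radialStableFourier d α (r • (v : Ed d)) (Vfun d α Λ v) ∂(ωd d) =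
      ∫ u, (∫ z, Complex.exp (-(Complex.I * (⟪r • (u : Ed d), z⟫ : ℂ))) * charFun μ z)
        ∂(ωd d) := by
  set σ : Measure (Set.Ioi (0 : ℝ)) := Measure.volumeIoiPow (d - 1) with hσ
  set J : Sph d → Sph d → ℂ := fun u v => ∫ ρ : Set.Ioi (0 : ℝ),
    Complex.exp (-(Complex.I * (⟪r • (u : Ed d), (ρ : ℝ) • (v : Ed d)⟫ : ℂ))) *
      charFun μ ((ρ : ℝ) • (v : Ed d)) ∂σ with hJ
  have hA : ∀ v : Sph d, radialStableFourier d α (r • (v : Ed d)) (Vfun d α Λ v) =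
      ∫ u, J u v ∂(ωd d) := by
    intro v
    have hi := integrable_polar hd
      (integrable_radialStableFourier hd hα (r • (v : Ed d)) (hm0.trans_le (hm v)))
    rw [radialStableFourier, integral_polar hd, integral_prod _ hi]
    refine integral_congr_ae (Eventually.of_forall fun u =>
      integral_congr_ae (Eventually.of_forall fun ρ => ?_))
    simp only
    rw [norm_smul_sphere, charFun_eq_cexp hμ, charExp_smul d Λ ρ.2, ← Vfun]
    simp only [real_inner_smul_left, real_inner_smul_right, real_inner_comm (u : Ed d)]
    congr 2
    push_cast
    ring
  have hB : ∀ u : Sph d,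
      ∫ z, Complex.exp (-(Complex.I * (⟪r • (u : Ed d), z⟫ : ℂ))) * charFun μ z =
      ∫ v, J u v ∂(ωd d) := by
    intro u
    have hi : Integrable fun z : Ed d =>
        Complex.exp (-(Complex.I * (⟪r • (u : Ed d), z⟫ : ℂ))) * charFun μ z := by
      refine (integrable_charFun hd hα hμ hm0 hm).norm.mono'
        (Continuous.aestronglyMeasurable (by fun_prop)) (Eventually.of_forall fun z => ?_)
      rw [norm_mul, norm_cexp_neg_I_mul, one_mul]
    rw [integral_polar hd, integral_prod _ (integrable_polar hd hi)]
  simp_rw [hA, hB]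
  refine (integral_integral_swap ?_)
  have hbound : Integrable (fun ρ : Set.Ioi (0 : ℝ) => Real.exp (-(m * (ρ : ℝ) ^ α))) σ :=
    (integrable_volumeIoiPow_iff (f := fun y : ℝ => Real.exp (-(m * y ^ α)))).2
      (integrableOn_pow_mul_exp_neg_mul_rpow _ hα hm0)
  refine Integrable.of_bound (C := ∫ ρ : Set.Ioi (0 : ℝ), Real.exp (-(m * (ρ : ℝ) ^ α)) ∂σ) ?_
    (Eventually.of_forall fun p => ?_)
  · have : StronglyMeasurable (fun q : (Sph d × Sph d) × Set.Ioi (0 : ℝ) =>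
        Complex.exp (-(Complex.I * (⟪r • (q.1.2 : Ed d), (q.2 : ℝ) • (q.1.1 : Ed d)⟫ : ℂ))) *
          charFun μ ((q.2 : ℝ) • (q.1.1 : Ed d))) :=
      Continuous.stronglyMeasurable (by fun_prop)
    exact this.integral_prod_right'.aestronglyMeasurable
  · refine norm_integral_le_of_norm_le hbound (Eventually.of_forall fun ρ => ?_)
    rw [norm_mul, norm_cexp_neg_I_mul, one_mul]
    exact norm_charFun_smul_le hμ hm ρ.2 _

/-- The density of `|X|` in terms of the density of `X`. -/
lemma map_norm_apply [IsProbabilityMeasure μ] (hd : 1 ≤ d) (hφ : Integrable (charFun μ))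
    {s : Set ℝ} (hs : MeasurableSet s) :
    μ.map (fun x : Ed d => ‖x‖) s = ENNReal.ofReal (∫ r in s ∩ Set.Ioi 0,
      r ^ (d - 1) * ∫ u, (charFunInv μ (r • (u : Ed d))).re ∂(ωd d)) := by
  have hc : Continuous fun x => (charFunInv μ x).re :=
    Complex.continuous_re.comp (continuous_charFunInv hφ)
  have h0 : ∀ x, 0 ≤ (charFunInv μ x).re := fun x => (charFunInv_nonneg hφ x).1
  have hi : Integrable fun x => (charFunInv μ x).re := by
    refine ⟨hc.aestronglyMeasurable, ?_⟩
    rw [hasFiniteIntegral_iff_ofReal (Eventually.of_forall h0), ← setLIntegral_univ,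
      ← withDensity_apply _ MeasurableSet.univ, ← eq_withDensity_charFunInv hφ]
    exact measure_lt_top _ _
  have hs' : MeasurableSet ((fun x : Ed d => ‖x‖) ⁻¹' s) := measurable_norm hs
  have hpolar := integrable_polar hd (hi.indicator hs')
  rw [Measure.map_apply measurable_norm hs]
  conv_lhs => rw [eq_withDensity_charFunInv hφ]
  rw [withDensity_apply _ hs', ← ofReal_integral_eq_lintegral_ofReal hi.integrableOn
    (Eventually.of_forall h0), ← integral_indicator hs', integral_polar hd,
    integral_prod_symm _ hpolar]
  congr 1
  calc _ = ∫ ρ : Set.Ioi (0 : ℝ), s.indicator (fun ρ =>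
          ∫ u, (charFunInv μ (ρ • (u : Ed d))).re ∂(ωd d)) ρ ∂(Measure.volumeIoiPow (d - 1)) := by
        refine integral_congr_ae (Eventually.of_forall fun ρ => ?_)
        by_cases h : (ρ : ℝ) ∈ s <;>
          simp [Set.indicator, norm_smul_sphere, h]
    _ = _ := by
        rw [integral_volumeIoiPow, Set.inter_comm, ← setIntegral_indicator hs]
        refine integral_congr_ae (Eventually.of_forall fun ρ => ?_)
        by_cases h : ρ ∈ s <;> simp [Set.indicator, h]

end Radial

/-- The subordination formula for the spherical average of the density. -/
lemma subordination_formula {d : ℕ} (hd : 1 ≤ d) {α : ℝ} (hα : 1 < α) {Λ : Measure (Sph d)}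
    {μ : Measure (Ed d)} [IsProbabilityMeasure μ] (hμ : IsStableChar d α Λ μ) {m : ℝ}
    (hm0 : 0 < m) (hm : ∀ u : Sph d, m ≤ (Vfun d α Λ u).re) (ν : Measure ℝ)
    [IsProbabilityMeasure ν] (hpos : ∀ᵐ s ∂ν, 0 < s)
    (hL : ∀ t : ℝ, 0 ≤ t → ∫ s, Real.exp (-(t * s)) ∂ν = Real.exp (-(t ^ (α / 2))))
    {r : ℝ} (hr : 0 < r) :
    (((r / 2) ^ (d - 1) / (2 * Real.pi ^ ((d : ℝ) / 2)) : ℝ) : ℂ) *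
        ∫ u, (Vfun d α Λ u) ^ ((-((d : ℝ) / α) : ℝ) : ℂ) *
          ∫ s, ((s ^ (-(d : ℝ) / 2) : ℝ) : ℂ) *
            Complex.exp (-(((r ^ 2 : ℝ) : ℂ) /
              (4 * (Vfun d α Λ u) ^ (((2 / α : ℝ)) : ℂ) * (s : ℂ)))) ∂ν ∂(ωd d) =
      ((r ^ (d - 1) * ∫ u, (charFunInv μ (r • (u : Ed d))).re ∂(ωd d) : ℝ) : ℂ) := by
  have hα0 : 0 < α := one_pos.trans hα
  have hφ := integrable_charFun hd hα0 hμ hm0 hm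
  have hπ : (0 : ℝ) < Real.pi ^ ((d : ℝ) / 2) := by positivity
  have h1 : ∀ u : Sph d, (Vfun d α Λ u) ^ ((-((d : ℝ) / α) : ℝ) : ℂ) *
          ∫ s, ((s ^ (-(d : ℝ) / 2) : ℝ) : ℂ) *
            Complex.exp (-(((r ^ 2 : ℝ) : ℂ) /
              (4 * (Vfun d α Λ u) ^ (((2 / α : ℝ)) : ℂ) * (s : ℂ)))) ∂ν =
      (((Real.pi ^ ((d : ℝ) / 2))⁻¹ : ℝ) : ℂ) *
        radialStableFourier d α (r • (u : Ed d)) (Vfun d α Λ u) := by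
    intro u
    rw [radialStableFourier_eq hd hα ν hpos hL _ (hm0.trans_le (hm u)),
      norm_smul_sphere ⟨r, hr⟩ u, ← mul_assoc, ← Complex.ofReal_mul, inv_mul_cancel₀ hπ.ne',
      Complex.ofReal_one, one_mul]
  have h2 : ∀ u : Sph d,
      ∫ z, Complex.exp (-(Complex.I * (⟪r • (u : Ed d), z⟫ : ℂ))) * charFun μ z =
      (((2 * Real.pi) ^ d : ℝ) : ℂ) * (((charFunInv μ (r • (u : Ed d))).re : ℝ) : ℂ) := by
    intro u
    have h : (((charFunInv μ (r • (u : Ed d))).re : ℝ) : ℂ) = charFunInv μ (r • (u : Ed d)) :=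
      Complex.ext rfl (charFunInv_nonneg hφ _).2.symm
    rw [h, charFunInv, finrank_euclideanSpace, Fintype.card_fin, ← mul_assoc,
      ← Complex.ofReal_mul, mul_inv_cancel₀ (by positivity), Complex.ofReal_one, one_mul]
  simp_rw [h1]
  rw [integral_const_mul, integral_radialStableFourier_Vfun hd hα0 hμ hm0 hm]
  simp_rw [h2]
  rw [integral_const_mul, integral_complex_ofReal, ← mul_assoc, ← mul_assoc,
    ← Complex.ofReal_mul, ← Complex.ofReal_mul, ← Complex.ofReal_mul]
  congr 2
  have hsq : Real.pi ^ ((d : ℝ) / 2) * Real.pi ^ ((d : ℝ) / 2) = Real.pi ^ d := by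
    rw [← Real.rpow_add Real.pi_pos, add_halves, Real.rpow_natCast]
  have h2d : (2 : ℝ) ^ d = 2 ^ (d - 1) * 2 := by
    rw [← pow_succ, Nat.sub_add_cancel hd]
  rw [div_pow, mul_pow, ← hsq, h2d]
  field_simp

/-- Corollary (subordination): with `ζ ∼ ν` a positive `(α/2)`-stable variable with
`E e^{-tζ} = e^{-t^{α/2}}`, the density of `|X|` is
`g_{|X|}(r) = ((r/2)^{d-1}/(2π^{d/2})) ∫ V^{-d/α} E[ζ^{-d/2} exp(-r²/(4V^{2/α}ζ))] dω`. -/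
theorem stmt15 (d : ℕ) (hd : 2 ≤ d) (α : ℝ) (hα1 : 1 < α) (hα2 : α < 2)
    (Λ : Measure (Sph d)) [IsFiniteMeasure Λ] (hΛ : Λ ≠ 0)
    (μ : Measure (Ed d)) [IsProbabilityMeasure μ] (hμ : IsStableChar d α Λ μ)
    (hnd : Nondegenerate d μ)
    (ν : Measure ℝ) [IsProbabilityMeasure ν] (hνpos : ν (Set.Ioi (0 : ℝ)) = 1)
    (hνLaplace : ∀ t : ℝ, 0 ≤ t →
      ∫ s, Real.exp (-(t * s)) ∂ν = Real.exp (-(t ^ (α / 2)))) :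
    (∀ r : ℝ, 0 < r →
      ((((r / 2) ^ (d - 1) / (2 * Real.pi ^ ((d : ℝ) / 2)) : ℝ) : ℂ) *
        ∫ u, (Vfun d α Λ u) ^ ((-((d : ℝ) / α) : ℝ) : ℂ) *
          ∫ s, ((s ^ (-(d : ℝ) / 2) : ℝ) : ℂ) *
            Complex.exp (-(((r ^ 2 : ℝ) : ℂ) /
              (4 * (Vfun d α Λ u) ^ (((2 / α : ℝ)) : ℂ) * (s : ℂ)))) ∂ν ∂(ωd d)).im = 0) ∧
    ∀ s : Set ℝ, MeasurableSet s →
      μ.map (fun x : Ed d => ‖x‖) s =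
        ENNReal.ofReal (∫ r in s ∩ Set.Ioi 0,
          ((((r / 2) ^ (d - 1) / (2 * Real.pi ^ ((d : ℝ) / 2)) : ℝ) : ℂ) *
            ∫ u, (Vfun d α Λ u) ^ ((-((d : ℝ) / α) : ℝ) : ℂ) *
              ∫ t, ((t ^ (-(d : ℝ) / 2) : ℝ) : ℂ) *
                Complex.exp (-(((r ^ 2 : ℝ) : ℂ) /
                  (4 * (Vfun d α Λ u) ^ (((2 / α : ℝ)) : ℂ) * (t : ℂ)))) ∂ν ∂(ωd d)).re) := by
  obtain ⟨m, hm0, hm⟩ := exists_le_re_Vfun (one_pos.trans hα1) hμ hnd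
  have hd1 : 1 ≤ d := one_le_two.trans hd
  have hpos : ∀ᵐ s ∂ν, 0 < s := (prob_compl_eq_zero_iff measurableSet_Ioi).2 hνpos
  refine ⟨fun r hr => ?_, fun s hs => ?_⟩
  · rw [subordination_formula hd1 hα1 hμ hm0 hm ν hpos hνLaplace hr, Complex.ofReal_im]
  · rw [map_norm_apply hd1 (integrable_charFun hd1 (one_pos.trans hα1) hμ hm0 hm) hs]
    congr 1
    refine setIntegral_congr_fun (hs.inter measurableSet_Ioi) fun r hr => ?_
    simp only
    rw [subordination_formula hd1 hα1 hμ hm0 hm ν hpos hνLaplace hr.2, Complex.ofReal_re]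

end StablePaper
end
end

section
/- Let d ≥ 2, α ∈ (1,2), and let μ be a nondegenerate α-stable distribution on ℝ^d with no shift, spectral spherical measure λ, and characteristic exponent Φ_μ(z) = |z|^α V(u_z). Define ϱ(z) = |z|²/(2 Re z) for complex z with Re z > 0, and ϱ₀ = sup_{u ∈ S^{d−1}} ϱ(V(u)). Then 0 < ϱ₀ < λ(S^{d−1})/(1 + cos(πα)) < ∞, and for every R > ϱ₀, sup_{u ∈ S^{d−1}} |R − V(u)| < R. -/
open MeasureTheory Real Filter Topology
open scoped RealInnerProductSpace ENNReal NNReal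

noncomputable section

namespace StablePaper

/-- The real part of the characteristic exponent, `∫ |⟨z,v⟩|^α Λ(dv)`. -/
def absMoment {d : ℕ} (α : ℝ) (Λ : Measure (Sph d)) (z : Ed d) : ℝ :=
  ∫ v : Sph d, |⟪z, (v : Ed d)⟫| ^ α ∂Λ

/-- The signed moment `∫ |⟨z,v⟩|^α sgn⟨z,v⟩ Λ(dv)`, with integrand in its continuous form. -/
def signedMoment {d : ℕ} (α : ℝ) (Λ : Measure (Sph d)) (z : Ed d) : ℝ :=
  ∫ v : Sph d, |⟪z, (v : Ed d)⟫| ^ (α - 1) * ⟪z, (v : Ed d)⟫ ∂Λ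

lemma abs_rpow_sub_one_mul_abs {α : ℝ} (hα : 1 < α) (x : ℝ) :
    |x| ^ (α - 1) * |x| = |x| ^ α := by
  rcases eq_or_ne x 0 with rfl | hx
  · simp [Real.zero_rpow (by linarith : α ≠ 0)]
  · rw [← Real.rpow_add_one (abs_ne_zero.mpr hx), sub_add_cancel]

lemma abs_rpow_mul_sign {α : ℝ} (hα : 1 < α) (x : ℝ) :
    |x| ^ α * Real.sign x = |x| ^ (α - 1) * x := by
  rw [← abs_rpow_sub_one_mul_abs hα, mul_assoc]
  congr 1
  rcases lt_trichotomy x 0 with h | rfl | h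
  · rw [Real.sign_of_neg h, abs_of_neg h]; ring
  · simp
  · rw [Real.sign_of_pos h, abs_of_pos h]; ring

lemma continuous_absMoment_integrand {d : ℕ} {α : ℝ} (hα : 1 < α) :
    Continuous fun p : Ed d × Sph d => |⟪p.1, (p.2 : Ed d)⟫| ^ α :=
  (Real.continuous_rpow_const (by linarith : 0 ≤ α)).comp (by fun_prop)

lemma continuous_signedMoment_integrand {d : ℕ} {α : ℝ} (hα : 1 < α) :
    Continuous fun p : Ed d × Sph d => |⟪p.1, (p.2 : Ed d)⟫| ^ (α - 1) * ⟪p.1, (p.2 : Ed d)⟫ :=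
  ((Real.continuous_rpow_const (by linarith : 0 ≤ α - 1)).comp
    (f := fun p : Ed d × Sph d => |⟪p.1, (p.2 : Ed d)⟫|) (by fun_prop)).mul (by fun_prop)

lemma abs_signedMoment_le {d : ℕ} {α : ℝ} {Λ : Measure (Sph d)} (hα : 1 < α) (z : Ed d) :
    |signedMoment α Λ z| ≤ absMoment α Λ z := by
  refine abs_integral_le_integral_abs.trans_eq (integral_congr_ae (ae_of_all _ fun v => ?_))
  simp only [abs_mul, abs_of_nonneg (Real.rpow_nonneg (abs_nonneg _) _)]
  exact abs_rpow_sub_one_mul_abs hα _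

lemma one_add_cos_pi_mul_pos {α : ℝ} (hα1 : 1 < α) (hα2 : α < 2) : 0 < 1 + Real.cos (Real.pi * α) := by
  have hc : Real.cos (Real.pi * α / 2) < 0 := by
    refine Real.cos_neg_of_pi_div_two_lt_of_lt ?_ ?_ <;> nlinarith [Real.pi_pos]
  have hcos : 1 + Real.cos (Real.pi * α) = 2 * Real.cos (Real.pi * α / 2) ^ 2 := by
    rw [Real.cos_sq]; ring_nf
  rw [hcos]
  nlinarith

lemma exists_ne_zero_inner_eq_zero {d : ℕ} (hd : 2 ≤ d) (u : Ed d) :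
    ∃ w : Ed d, w ≠ 0 ∧ ⟪w, u⟫ = 0 := by
  have hne : (ℝ ∙ u)ᗮ ≠ ⊥ := by
    intro h
    rw [Submodule.orthogonal_eq_bot_iff] at h
    have h1 := finrank_span_le_card (R := ℝ) ({u} : Set (Ed d))
    rw [h, finrank_top, finrank_euclideanSpace_fin, Set.toFinset_singleton, Finset.card_singleton] at h1
    omega
  obtain ⟨w, hw, hw0⟩ := Submodule.exists_mem_ne_zero_of_ne_bot hne
  exact ⟨w, hw0, Submodule.mem_orthogonal_singleton_iff_inner_left.mp hw⟩

section

variable {d : ℕ} {α : ℝ} {Λ : Measure (Sph d)} [IsFiniteMeasure Λ]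

lemma integrable_of_continuous_uncurry {f : Ed d × Sph d → ℝ} (hf : Continuous f) (z : Ed d) :
    Integrable (fun v => f (z, v)) Λ :=
  (hf.comp (by fun_prop : Continuous fun v : Sph d => (z, v))).integrable_of_hasCompactSupport
    (HasCompactSupport.of_compactSpace _)

lemma continuous_absMoment (hα : 1 < α) : Continuous (absMoment α Λ) := by
  unfold absMoment
  simpa using continuous_parametric_integral_of_continuous (μ := Λ)
    (f := fun (z : Ed d) (v : Sph d) => |⟪z, (v : Ed d)⟫| ^ α)
    (continuous_absMoment_integrand hα) isCompact_univ

lemma continuous_signedMoment (hα : 1 < α) : Continuous (signedMoment α Λ) := by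
  unfold signedMoment
  simpa using continuous_parametric_integral_of_continuous (μ := Λ)
    (f := fun (z : Ed d) (v : Sph d) => |⟪z, (v : Ed d)⟫| ^ (α - 1) * ⟪z, (v : Ed d)⟫)
    (continuous_signedMoment_integrand hα) isCompact_univ

lemma charExp_eq (hα : 1 < α) (z : Ed d) :
    charExp d α Λ z = (absMoment α Λ z : ℂ) -
      Complex.I * (Real.tan (Real.pi * α / 2) : ℂ) * (signedMoment α Λ z : ℂ) := by
  have h1 := integrable_of_continuous_uncurry (Λ := Λ) (continuous_absMoment_integrand hα) z
  have h2 := integrable_of_continuous_uncurry (Λ := Λ) (continuous_signedMoment_integrand hα) z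
  rw [absMoment, signedMoment, ← integral_complex_ofReal, ← integral_complex_ofReal,
    ← integral_const_mul, ← integral_sub h1.ofReal (h2.ofReal.const_mul _), charExp]
  congr 1
  ext v
  rw [← abs_rpow_mul_sign hα]
  push_cast
  ring

lemma charExp_re (hα : 1 < α) (z : Ed d) : (charExp d α Λ z).re = absMoment α Λ z := by
  simp [charExp_eq hα, -Complex.ofReal_tan]

lemma charExp_im (hα : 1 < α) (z : Ed d) :
    (charExp d α Λ z).im = -(Real.tan (Real.pi * α / 2) * signedMoment α Λ z) := by
  simp [charExp_eq hα, -Complex.ofReal_tan]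

lemma continuous_charExp (hα : 1 < α) : Continuous (charExp d α Λ) := by
  have h1 : Continuous (absMoment α Λ) := continuous_absMoment hα
  have h2 : Continuous (signedMoment α Λ) := continuous_signedMoment hα
  rw [funext (charExp_eq (Λ := Λ) hα)]
  fun_prop

lemma sq_norm_charExp_le (hα1 : 1 < α) (hα2 : α < 2) (z : Ed d) :
    ‖charExp d α Λ z‖ ^ 2 ≤ absMoment α Λ z ^ 2 * (2 / (1 + Real.cos (Real.pi * α))) := by
  have hc : Real.cos (Real.pi * α / 2) ≠ 0 := by
    refine (Real.cos_neg_of_pi_div_two_lt_of_lt ?_ ?_).ne <;> nlinarith [Real.pi_pos]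
  have hcos : 1 + Real.cos (Real.pi * α) = 2 * Real.cos (Real.pi * α / 2) ^ 2 := by
    rw [Real.cos_sq]; ring_nf
  have ht : 2 / (1 + Real.cos (Real.pi * α)) = 1 + Real.tan (Real.pi * α / 2) ^ 2 := by
    rw [hcos, Real.tan_eq_sin_div_cos]
    field_simp
    linarith [Real.sin_sq_add_cos_sq (Real.pi * α / 2)]
  have hb : signedMoment α Λ z ^ 2 ≤ absMoment α Λ z ^ 2 :=
    sq_le_sq' (abs_le.mp (abs_signedMoment_le hα1 z)).1 (abs_le.mp (abs_signedMoment_le hα1 z)).2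
  rw [ht, Complex.sq_norm, Complex.normSq_apply, charExp_re hα1, charExp_im hα1]
  nlinarith [mul_le_mul_of_nonneg_left hb (sq_nonneg (Real.tan (Real.pi * α / 2)))]

lemma absMoment_pos {μ : Measure (Ed d)} [IsProbabilityMeasure μ] (hα : 1 < α)
    (hμ : IsStableChar d α Λ μ) (hnd : Nondegenerate d μ) {z : Ed d} (hz : z ≠ 0) :
    0 < absMoment α Λ z := by
  have hnn : 0 ≤ absMoment α Λ z :=
    integral_nonneg fun v => Real.rpow_nonneg (abs_nonneg _) _
  refine hnn.lt_of_ne' fun h0 => ?_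
  have hae : ∀ᵐ v : Sph d ∂Λ, ⟪z, (v : Ed d)⟫ = 0 := by
    have h := (integral_eq_zero_iff_of_nonneg
      (fun v : Sph d => Real.rpow_nonneg (abs_nonneg ⟪z, (v : Ed d)⟫) α)
      (integrable_of_continuous_uncurry (continuous_absMoment_integrand hα) z)).mp h0
    filter_upwards [h] with v hv
    exact abs_eq_zero.mp ((Real.rpow_eq_zero (abs_nonneg _) (by linarith)).mp hv)
  have hmeas : Measurable fun x : Ed d => ⟪z, x⟫ := by fun_prop
  have hexp (s : ℝ) : charExp d α Λ (s • z) = 0 := by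
    rw [charExp]
    refine integral_eq_zero_of_ae ?_
    filter_upwards [hae] with v hv
    simp [real_inner_smul_left, hv, Real.zero_rpow (by linarith : α ≠ 0)]
  have hdirac : μ.map (fun x => ⟪z, x⟫) = Measure.dirac 0 := by
    have : IsProbabilityMeasure (μ.map fun x : Ed d => ⟪z, x⟫) :=
      Measure.isProbabilityMeasure_map hmeas.aemeasurable
    refine Measure.ext_of_charFun (funext fun s => ?_)
    have h := hμ (s • z)
    rw [hexp s, neg_zero, Complex.exp_zero] at h
    rw [charFun_dirac, charFun_apply_real, integral_map hmeas.aemeasurable (by fun_prop)]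
    simp only [inner_zero_left, Complex.ofReal_zero, zero_mul, Complex.exp_zero]
    rw [← h]
    congr 1
    ext x
    rw [real_inner_smul_left]
    push_cast
    ring_nf
  have hW : (ℝ ∙ z)ᗮ ≠ ⊤ := by
    intro h
    have : z ∈ (ℝ ∙ z)ᗮ := h ▸ Submodule.mem_top
    exact hz (inner_self_eq_zero.mp (Submodule.mem_orthogonal_singleton_iff_inner_right.mp this))
  have hlt := hnd 0 _ hW
  have hset : (fun x => (0 : Ed d) + x) '' ((ℝ ∙ z)ᗮ : Set (Ed d)) =
      (fun x : Ed d => ⟪z, x⟫) ⁻¹' {0} := by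
    ext x
    simp [Submodule.mem_orthogonal_singleton_iff_inner_right]
  rw [hset, ← Measure.map_apply hmeas (measurableSet_singleton 0), hdirac] at hlt
  simp at hlt

lemma absMoment_lt_measure_univ (hd : 2 ≤ d) (hα : 1 < α)
    (hpos : ∀ z : Ed d, z ≠ 0 → 0 < absMoment α Λ z) (u : Sph d) :
    absMoment α Λ u < (Λ Set.univ).toReal := by
  have hle (v : Sph d) : |⟪(u : Ed d), (v : Ed d)⟫| ≤ 1 := by
    simpa using abs_real_inner_le_norm (u : Ed d) (v : Ed d)
  have hle' (v : Sph d) : |⟪(u : Ed d), (v : Ed d)⟫| ^ α ≤ 1 :=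
    Real.rpow_le_one (abs_nonneg _) (hle v) (by linarith)
  have hint := integrable_of_continuous_uncurry (Λ := Λ)
    (continuous_absMoment_integrand hα) (u : Ed d)
  have hsub : ∫ v : Sph d, (1 - |⟪(u : Ed d), (v : Ed d)⟫| ^ α) ∂Λ =
      (Λ Set.univ).toReal - absMoment α Λ u := by
    rw [integral_sub (integrable_const 1) hint]
    simp [absMoment, Measure.real]
  have hnn : 0 ≤ fun v : Sph d => 1 - |⟪(u : Ed d), (v : Ed d)⟫| ^ α :=
    fun v => sub_nonneg.mpr (hle' v)
  have h0 := integral_nonneg (μ := Λ) hnn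
  rw [hsub] at h0
  refine (sub_nonneg.mp h0).lt_of_ne fun heq => ?_
  have hae := (integral_eq_zero_iff_of_nonneg hnn ((integrable_const 1).sub hint)).mp
    (hsub.trans (by rw [heq, sub_self]))
  obtain ⟨w, hw0, hw⟩ := exists_ne_zero_inner_eq_zero hd (u : Ed d)
  refine (hpos w hw0).ne' (integral_eq_zero_of_ae ?_)
  filter_upwards [hae] with v hv
  have h1 : |⟪(u : Ed d), (v : Ed d)⟫| = 1 := by
    refine (Real.rpow_left_inj (abs_nonneg _) zero_le_one (by linarith : α ≠ 0)).mp ?_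
    rw [Real.one_rpow]
    exact (sub_eq_zero.mp hv).symm
  have h2 : |⟪(u : Ed d), (v : Ed d)⟫ / (‖(u : Ed d)‖ * ‖(v : Ed d)‖)| = 1 := by simpa using h1
  obtain ⟨-, r, -, hr⟩ := abs_real_inner_div_norm_mul_norm_eq_one_iff _ _ |>.mp h2
  simp [hr, real_inner_smul_right, hw, Real.zero_rpow (by linarith : α ≠ 0)]

end

lemma exists_forall_le_of_compactSpace {X : Type*} [TopologicalSpace X] [CompactSpace X]
    [Nonempty X] {f : X → ℝ} (hf : Continuous f) : ∃ x, ∀ y, f y ≤ f x :=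
  let ⟨x, _, hx⟩ := isCompact_univ.exists_isMaxOn Set.univ_nonempty hf.continuousOn
  ⟨x, fun y => hx (Set.mem_univ y)⟩

/-- If `Re z > 0`, then `z` lies in the open disk of center and radius `R` as soon as
`|z|² / (2 Re z) < R`. -/
lemma norm_ofReal_sub_lt {z : ℂ} {R : ℝ} (hz : 0 < z.re) (hR : 0 < R)
    (h : ‖z‖ ^ 2 / (2 * z.re) < R) : ‖(R : ℂ) - z‖ < R := by
  rw [div_lt_iff₀ (by positivity), Complex.sq_norm, Complex.normSq_apply] at h
  refine lt_of_pow_lt_pow_left₀ 2 hR.le ?_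
  rw [Complex.sq_norm, Complex.normSq_apply]
  simp only [Complex.sub_re, Complex.sub_im, Complex.ofReal_re, Complex.ofReal_im]
  nlinarith

/-- Lemma: with `ϱ(z) = |z|²/(2 Re z)` and `ϱ₀ = sup_u ϱ(V(u))`,
`0 < ϱ₀ < λ(S^{d-1})/(1+cos(πα)) < ∞`, and for every `R > ϱ₀`, `sup_u |R - V(u)| < R`. -/
theorem stmt16 (d : ℕ) (hd : 2 ≤ d) (α : ℝ) (hα1 : 1 < α) (hα2 : α < 2)
    (Λ : Measure (Sph d)) [IsFiniteMeasure Λ] (hΛ : Λ ≠ 0)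
    (μ : Measure (Ed d)) [IsProbabilityMeasure μ] (hμ : IsStableChar d α Λ μ)
    (hnd : Nondegenerate d μ) :
    0 < (⨆ u : Sph d, ‖Vfun d α Λ u‖ ^ 2 / (2 * (Vfun d α Λ u).re)) ∧
    (⨆ u : Sph d, ‖Vfun d α Λ u‖ ^ 2 / (2 * (Vfun d α Λ u).re)) <
      (Λ Set.univ).toReal / (1 + Real.cos (Real.pi * α)) ∧
    ∀ R : ℝ, (⨆ u : Sph d, ‖Vfun d α Λ u‖ ^ 2 / (2 * (Vfun d α Λ u).re)) < R →
      (⨆ u : Sph d, ‖(R : ℂ) - Vfun d α Λ u‖) < R := by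
  have hpos : ∀ z : Ed d, z ≠ 0 → 0 < absMoment α Λ z :=
    fun z hz => absMoment_pos hα1 hμ hnd hz
  have hre (u : Sph d) : 0 < (Vfun d α Λ u).re := by
    rw [Vfun, charExp_re hα1]
    exact hpos u (ne_zero_of_mem_unit_sphere u)
  have hV : Continuous (Vfun d α Λ) := (continuous_charExp hα1).comp continuous_subtype_val
  have : Nonempty (Sph d) := by
    have : Nontrivial (Ed d) := Module.nontrivial_of_finrank_pos (R := ℝ) (by simp; omega)
    exact (NormedSpace.sphere_nonempty.mpr zero_le_one).to_subtype
  have hρ : Continuous fun u : Sph d => ‖Vfun d α Λ u‖ ^ 2 / (2 * (Vfun d α Λ u).re) :=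
    (by fun_prop : Continuous fun u => ‖Vfun d α Λ u‖ ^ 2).div
      (continuous_const.mul (Complex.continuous_re.comp hV)) fun u => by
        have := hre u
        positivity
  obtain ⟨u₀, hu₀⟩ := exists_forall_le_of_compactSpace hρ
  have hsup : (⨆ u : Sph d, ‖Vfun d α Λ u‖ ^ 2 / (2 * (Vfun d α Λ u).re)) =
      ‖Vfun d α Λ u₀‖ ^ 2 / (2 * (Vfun d α Λ u₀).re) :=
    le_antisymm (ciSup_le hu₀) (le_ciSup (f := fun u : Sph d =>
      ‖Vfun d α Λ u‖ ^ 2 / (2 * (Vfun d α Λ u).re)) ⟨_, Set.forall_mem_range.mpr hu₀⟩ u₀)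
  have hsup_pos : 0 < ‖Vfun d α Λ u₀‖ ^ 2 / (2 * (Vfun d α Λ u₀).re) := by
    have h := hre u₀
    have : Vfun d α Λ u₀ ≠ 0 := fun h0 => by simp [h0] at h
    positivity
  rw [hsup]
  refine ⟨hsup_pos, ?_, fun R hR => ?_⟩
  · have hc := one_add_cos_pi_mul_pos hα1 hα2
    have h := hre u₀
    have hle := sq_norm_charExp_le (Λ := Λ) hα1 hα2 (u₀ : Ed d)
    have hlt := absMoment_lt_measure_univ hd hα1 hpos u₀
    have hreq : (Vfun d α Λ u₀).re = absMoment α Λ u₀ := charExp_re hα1 _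
    rw [hreq] at h ⊢
    refine lt_of_le_of_lt ?_ (div_lt_div_of_pos_right hlt hc)
    rw [div_le_iff₀ (by positivity)]
    refine hle.trans_eq ?_
    field_simp
  · have hcont : Continuous fun u : Sph d => ‖(R : ℂ) - Vfun d α Λ u‖ := by fun_prop
    obtain ⟨u₁, hu₁⟩ := exists_forall_le_of_compactSpace hcont
    exact (ciSup_le hu₁).trans_lt
      (norm_ofReal_sub_lt (hre u₁) (hsup_pos.trans hR) ((hu₀ u₁).trans_lt hR))

end StablePaper
end
end
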